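/- arXiv:1806.07522 — 3 statements merged into one kernel-verified Lean document; each statement's English description precedes it below -/
import Mathlib

section
/- Let R be a Noetherian ring of prime characteristic p and let I be an ideal generated by a regular sequence x_1,...,x_d. Then for all n ≥ 0, the intersection I^n ∩ (I^{n+1})^* equals I^n · I^*, where J^* denotes the tight closure of the ideal J. -/
/-- The Frobenius power `I^[q]` of an ideal: the ideal generated by `q`-th powers of
elements of `I`. -/
def Ideal.frobeniusPower {R : Type*} [CommRing R] (I : Ideal R) (q : ℕ) : Ideal R :=
  Ideal.span ((· ^ q) '' (I : Set R))

/-- `x` belongs to the tight closure of `I` (in characteristic `p`): there is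
`c ∈ R°` (not in any minimal prime) with `c * x^q ∈ I^[q]` for all large `q = p^e`. -/
def Ideal.memTightClosure {R : Type*} [CommRing R] (p : ℕ) (I : Ideal R) (x : R) : Prop :=
  ∃ c : R, (∀ P ∈ minimalPrimes R, c ∉ P) ∧
    ∃ N : ℕ, ∀ e : ℕ, N ≤ e → c * x ^ p ^ e ∈ I.frobeniusPower (p ^ e)

/-- The tight closure `I^*` of an ideal `I`. -/
def Ideal.tightClosure {R : Type*} [CommRing R] (p : ℕ) (I : Ideal R) : Ideal R :=
  Ideal.span {x : R | I.memTightClosure p x}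

open MvPolynomial

namespace RingTheory.Sequence

universe u v

variable {R : Type u} [CommRing R]

/-- The middle term of a short exact sequence is weakly regular when the outer terms are. -/
theorem IsWeaklyRegular.of_shortExact {rs : List R} {M M' M'' : Type v}
    [AddCommGroup M] [Module R M] [AddCommGroup M'] [Module R M'] [AddCommGroup M''] [Module R M'']
    {f : M →ₗ[R] M'} {g : M' →ₗ[R] M''} (hf : Function.Injective f)
    (hfg : Function.Exact f g) (hg : Function.Surjective g)
    (h : IsWeaklyRegular M rs) (h'' : IsWeaklyRegular M'' rs) : IsWeaklyRegular M' rs := by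
  induction rs generalizing M M' M'' with
  | nil => exact .nil R M'
  | cons r rs ih =>
    rw [isWeaklyRegular_cons_iff] at h h'' ⊢
    refine ⟨isSMulRegular_of_range_eq_ker hf hfg.linearMap_ker_eq.symm h.1 h''.1,
      ih (f := QuotSMulTop.map r f) (g := QuotSMulTop.map r g) ?_
        (QuotSMulTop.map_exact r hfg hg) (QuotSMulTop.map_surjective r hg) h.2 h''.2⟩
    have h₀ : Function.Exact (0 : M →ₗ[R] M) f := by
      intro x
      rw [map_eq_zero_iff f hf]
      simp [eq_comm]
    have h₁ := QuotSMulTop.map_first_exact_on_four_term_exact_of_isSMulRegular_last h₀ hfg h''.1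
    rw [← LinearMap.ker_eq_bot, h₁.linearMap_ker_eq, map_zero, LinearMap.range_zero]

/-- If `a` is a nonzerodivisor on `M`, a sequence weakly regular on `M / aM` is weakly regular on
`M / aⁿM`. -/
theorem IsWeaklyRegular.quotSMulTop_pow {rs : List R} {M : Type v} [AddCommGroup M] [Module R M]
    {a : R} (ha : IsSMulRegular M a) (h : IsWeaklyRegular (QuotSMulTop a M) rs) (n : ℕ) :
    IsWeaklyRegular (QuotSMulTop (a ^ (n + 1)) M) rs := by
  induction n with
  | zero => rwa [zero_add, pow_one]
  | succ n ih =>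
    let f : QuotSMulTop (a ^ (n + 1)) M →ₗ[R] QuotSMulTop (a ^ (n + 2)) M :=
      Submodule.mapQ _ _ (LinearMap.lsmul R M a) (by
        rintro _ ⟨y, -, rfl⟩
        exact ⟨y, trivial, by simp [smul_smul, pow_succ' a (n + 1), mul_comm]⟩)
    let g : QuotSMulTop (a ^ (n + 2)) M →ₗ[R] QuotSMulTop a M :=
      Submodule.mapQ _ _ LinearMap.id (by
        rintro _ ⟨y, -, rfl⟩
        exact ⟨a ^ (n + 1) • y, trivial, by simp [smul_smul, pow_succ' a (n + 1), mul_comm]⟩)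
    refine IsWeaklyRegular.of_shortExact (f := f) (g := g) ?_ ?_ ?_ ih h
    · rw [injective_iff_map_eq_zero]
      intro x
      obtain ⟨x, rfl⟩ := Submodule.Quotient.mk_surjective _ x
      intro hx
      obtain ⟨y, -, hy⟩ := (Submodule.Quotient.mk_eq_zero _).mp hx
      refine (Submodule.Quotient.mk_eq_zero _).mpr ⟨y, trivial, ha ?_⟩
      simpa [smul_smul, pow_succ' a (n + 1)] using hy
    · intro x
      obtain ⟨x, rfl⟩ := Submodule.Quotient.mk_surjective _ x
      constructor
      · intro hx
        obtain ⟨y, -, hy⟩ := (Submodule.Quotient.mk_eq_zero _).mp hx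
        exact ⟨Submodule.Quotient.mk y, congrArg Submodule.Quotient.mk hy⟩
      · rintro ⟨y, hy⟩
        obtain ⟨y, rfl⟩ := Submodule.Quotient.mk_surjective _ y
        rw [← hy]
        exact (Submodule.Quotient.mk_eq_zero _).mpr ⟨y, trivial, rfl⟩
    · intro x
      obtain ⟨x, rfl⟩ := Submodule.Quotient.mk_surjective _ x
      exact ⟨Submodule.Quotient.mk x, rfl⟩

/-- Replacing the terms of a weakly regular sequence by a positive power preserves weak
regularity. -/
theorem IsWeaklyRegular.map_pow {rs : List R} {M : Type v} [AddCommGroup M] [Module R M]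
    (h : IsWeaklyRegular M rs) {n : ℕ} (hn : 0 < n) :
    IsWeaklyRegular M (rs.map (· ^ n)) := by
  obtain ⟨n, rfl⟩ := Nat.exists_eq_succ_of_ne_zero hn.ne'
  induction rs generalizing M with
  | nil => exact .nil R M
  | cons a rs ih =>
    rw [isWeaklyRegular_cons_iff] at h
    rw [List.map_cons, isWeaklyRegular_cons_iff]
    exact ⟨h.1.pow _, ih (h.2.quotSMulTop_pow h.1 n)⟩

/-- The ideal of a prefix of a list, as the span of an initial segment of the terms. -/
theorem span_getD_image_Iio (rs : List R) {i : ℕ} (hi : i ≤ rs.length) :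
    Ideal.span ((fun j ↦ rs.getD j 0) '' Set.Iio i) = Ideal.ofList (rs.take i) := by
  refine congrArg Ideal.span (Set.ext fun r ↦ ?_)
  simp only [Set.mem_image, Set.mem_Iio, Set.mem_ofPred_eq, List.mem_take_iff_getElem]
  constructor
  · rintro ⟨j, hj, rfl⟩
    exact ⟨j, by lia, (List.getD_eq_getElem _ _ (by lia)).symm⟩
  · rintro ⟨j, hj, rfl⟩
    exact ⟨j, by lia, List.getD_eq_getElem _ _ (by lia)⟩

/-- Elementwise form of weak regularity on the ring itself. -/
theorem IsWeaklyRegular.mem_of_getD_mul_mem {rs : List R} (h : IsWeaklyRegular R rs) {i : ℕ}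
    (hi : i < rs.length) {r : R}
    (hr : rs.getD i 0 * r ∈ Ideal.span ((fun j ↦ rs.getD j 0) '' Set.Iio i)) :
    r ∈ Ideal.span ((fun j ↦ rs.getD j 0) '' Set.Iio i) := by
  rw [span_getD_image_Iio rs hi.le] at hr ⊢
  have := mem_of_isSMulRegular_quotient_of_smul_mem (h.regular_mod_prev i hi) (x := r)
  rw [smul_eq_mul, Ideal.mul_top] at this
  rw [List.getD_eq_getElem _ _ hi] at hr
  exact this hr

end RingTheory.Sequence

namespace MvPolynomial

variable {R σ : Type*} [CommRing R]

/-- Evaluating a form of degree `n` with coefficients in `K` at elements of `I` gives an element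
of `Iⁿ * K`. -/
theorem IsHomogeneous.eval_mem_pow_mul {F : MvPolynomial σ R} {n : ℕ} (hF : F.IsHomogeneous n)
    {x : σ → R} {I K : Ideal R} (hx : ∀ i ∈ F.vars, x i ∈ I) (hK : ∀ m, coeff m F ∈ K) :
    eval x F ∈ I ^ n * K := by
  rw [eval_eq]
  refine Ideal.sum_mem _ fun m hm ↦ ?_
  rw [mul_comm (coeff m F)]
  refine Ideal.mul_mem_mul ?_ (hK m)
  rw [hF.degree_eq_sum_deg_support hm, ← Finset.prod_pow_eq_pow_sum]
  exact Ideal.prod_mem_prod fun i hi ↦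
    Ideal.pow_mem_pow (hx i ((mem_vars_iff_mem_support i).mpr ⟨m, hm, hi⟩)) _

/-- Every element of `Iⁿ * K`, with `I` generated by `x i` for `i ∈ s`, is the value at `x` of a
form of degree `n` in the variables from `s` with coefficients in `K`. -/
theorem exists_isHomogeneous_eval_eq {x : σ → R} {s : Set σ} {K : Ideal R} {n : ℕ} {y : R}
    (hy : y ∈ Ideal.span (x '' s) ^ n * K) :
    ∃ F : MvPolynomial σ R, F.IsHomogeneous n ∧ F ∈ supported R s ∧
      (∀ m, coeff m F ∈ K) ∧ eval x F = y := by
  induction n generalizing y with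
  | zero =>
    rw [pow_zero, one_mul] at hy
    refine ⟨C y, isHomogeneous_C _ _, (supported R s).algebraMap_mem y, fun m ↦ ?_, eval_C _⟩
    classical
    rw [coeff_C]
    split_ifs
    exacts [hy, K.zero_mem]
  | succ n ih =>
    rw [pow_succ', mul_assoc] at hy
    have hadd : ∀ a b : R,
        (∃ F : MvPolynomial σ R, F.IsHomogeneous (n + 1) ∧ F ∈ supported R s ∧
          (∀ m, coeff m F ∈ K) ∧ eval x F = a) →
        (∃ F : MvPolynomial σ R, F.IsHomogeneous (n + 1) ∧ F ∈ supported R s ∧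
          (∀ m, coeff m F ∈ K) ∧ eval x F = b) →
        ∃ F : MvPolynomial σ R, F.IsHomogeneous (n + 1) ∧ F ∈ supported R s ∧
          (∀ m, coeff m F ∈ K) ∧ eval x F = a + b := by
      rintro _ _ ⟨F, hF, hFs, hFK, rfl⟩ ⟨G, hG, hGs, hGK, rfl⟩
      exact ⟨F + G, hF.add hG, add_mem hFs hGs,
        fun m ↦ by rw [coeff_add]; exact K.add_mem (hFK m) (hGK m), map_add _ _ _⟩
    refine Submodule.mul_induction_on hy (fun a ha b hb ↦ ?_) hadd
    obtain ⟨F, hF, hFs, hFK, rfl⟩ := ih hb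
    induction ha using Submodule.span_induction with
    | mem a ha =>
      obtain ⟨i, hi, rfl⟩ := ha
      refine ⟨X i * F, by simpa [add_comm] using (isHomogeneous_X R i).mul hF,
        mul_mem ?_ hFs, fun m ↦ ?_, by simp⟩
      · rw [supported_eq_adjoin_X]
        exact Algebra.subset_adjoin ⟨i, hi, rfl⟩
      · classical
        rw [coeff_X_mul']
        split_ifs
        exacts [hFK _, K.zero_mem]
    | zero => exact ⟨0, isHomogeneous_zero _ _ _, zero_mem _, fun m ↦ by simp, by simp⟩
    | add a b _ _ iha ihb =>
      rw [add_mul]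
      exact hadd _ _ iha ihb
    | smul r a _ iha =>
      obtain ⟨G, hG, hGs, hGK, hGa⟩ := iha
      exact ⟨C r * G, hG.C_mul r, mul_mem ((supported R s).algebraMap_mem r) hGs,
        fun m ↦ by rw [coeff_C_mul]; exact K.mul_mem_left r (hGK m), by simp [hGa, mul_assoc]⟩

/-- The elements `x i`, `i ∈ s`, generating an ideal `I`, are quasi-regular in degree `n`: a form
of degree `n` vanishing at `x` has all its coefficients in `I`. -/
def QuasiRegularInDegree (x : σ → R) (s : Set σ) (n : ℕ) : Prop :=
  ∀ F : MvPolynomial σ R, F.IsHomogeneous n → F ∈ supported R s → eval x F = 0 →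
    ∀ m, coeff m F ∈ Ideal.span (x '' s)

theorem QuasiRegularInDegree.coeff_mem {x : σ → R} {s : Set σ} {n : ℕ}
    (h : QuasiRegularInDegree x s n) {F : MvPolynomial σ R} (hF : F.IsHomogeneous n)
    (hFs : F ∈ supported R s) (hFx : eval x F ∈ Ideal.span (x '' s) ^ (n + 1)) (m : σ →₀ ℕ) :
    coeff m F ∈ Ideal.span (x '' s) := by
  rw [pow_succ] at hFx
  obtain ⟨G, hG, hGs, hGI, hGx⟩ := exists_isHomogeneous_eval_eq hFx
  have := h (F - G) (hF.sub hG) (sub_mem hFs hGs) (by rw [map_sub, hGx, sub_self]) m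
  rw [coeff_sub] at this
  exact (Submodule.sub_mem_iff_left _ (hGI m)).mp this

/-- A nonzerodivisor modulo a quasi-regularly generated ideal is a nonzerodivisor modulo its
powers. -/
theorem mem_pow_of_mul_mem_pow {x : σ → R} {s : Set σ} (h : ∀ n, QuasiRegularInDegree x s n)
    {y : R} (hy : ∀ r, y * r ∈ Ideal.span (x '' s) → r ∈ Ideal.span (x '' s)) {k : ℕ} {r : R}
    (hr : y * r ∈ Ideal.span (x '' s) ^ k) : r ∈ Ideal.span (x '' s) ^ k := by
  induction k with
  | zero => simp
  | succ k ih =>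
    have hrk := ih (Ideal.pow_le_pow_right k.le_succ hr)
    rw [← Ideal.mul_top (Ideal.span (x '' s) ^ k)] at hrk
    obtain ⟨F, hF, hFs, -, rfl⟩ := exists_isHomogeneous_eval_eq hrk
    rw [pow_succ]
    refine hF.eval_mem_pow_mul
      (fun i hi ↦ Ideal.subset_span ⟨i, mem_supported.mp hFs hi, rfl⟩) fun m ↦ hy _ ?_
    rw [← coeff_C_mul]
    refine (h k).coeff_mem (hF.C_mul y) (mul_mem ((supported R s).algebraMap_mem y) hFs) ?_ m
    rwa [eval_mul, eval_C]

/-- Quasi-regularity is preserved on appending an element that is a nonzerodivisor modulo the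
previous ones. -/
theorem quasiRegularInDegree_insert {x : σ → R} {s : Set σ} {i : σ}
    (h : ∀ n, QuasiRegularInDegree x s n)
    (hi : ∀ r, x i * r ∈ Ideal.span (x '' s) → r ∈ Ideal.span (x '' s)) (n : ℕ) :
    QuasiRegularInDegree x (insert i s) n := by
  have hle : Ideal.span (x '' s) ≤ Ideal.span (x '' insert i s) :=
    Ideal.span_mono (Set.image_mono (Set.subset_insert i s))
  induction n with
  | zero =>
    intro F hF _ hFx m
    rw [← totalDegree_zero_iff_isHomogeneous, totalDegree_eq_zero_iff_eq_C] at hF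
    rw [hF, eval_C] at hFx
    rw [hF, hFx]
    simp
  | succ n ih =>
    intro F hF hFs hFx
    have hsplit := modMonomial_add_divMonomial_single F i
    set G := F.modMonomial (Finsupp.single i 1)
    set H := F.divMonomial (Finsupp.single i 1)
    have hH : H.IsHomogeneous n := by
      intro m hm
      have := hF (d := Finsupp.single i 1 + m) hm
      rw [map_add, Finsupp.weight_single] at this
      rw [Pi.one_apply, smul_eq_mul, mul_one] at this
      lia
    have hHs : H ∈ supported R (insert i s) := by
      rw [mem_supported] at hFs ⊢
      intro j hj
      obtain ⟨m, hm, hjm⟩ := (mem_vars_iff_mem_support j).mp hj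
      refine hFs ((mem_vars_iff_mem_support j).mpr
        ⟨Finsupp.single i 1 + m, by
          rw [mem_support_iff] at hm ⊢
          exact hm, ?_⟩)
      rw [Finsupp.mem_support_iff] at hjm ⊢
      rw [Finsupp.add_apply]
      lia
    have hGc : ∀ m, coeff m G ≠ 0 → coeff m F ≠ 0 ∧ m i = 0 := by
      intro m hm
      have hmi : ¬ Finsupp.single i 1 ≤ m := fun hle ↦ hm (coeff_modMonomial_of_le F hle)
      refine ⟨by rwa [← coeff_modMonomial_of_not_le F hmi], ?_⟩
      rw [Finsupp.single_le_iff] at hmi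
      lia
    have hG : G.IsHomogeneous (n + 1) := fun m hm ↦ hF (hGc m hm).1
    have hGs : G ∈ supported R s := by
      rw [mem_supported] at hFs ⊢
      intro j hj
      obtain ⟨m, hm, hjm⟩ := (mem_vars_iff_mem_support j).mp hj
      have hm' := hGc m (mem_support_iff.mp hm)
      refine (hFs ((mem_vars_iff_mem_support j).mpr
        ⟨m, mem_support_iff.mpr hm'.1, hjm⟩)).resolve_left ?_
      rintro rfl
      exact Finsupp.mem_support_iff.mp hjm hm'.2
    have hsum : eval x G + x i * eval x H = 0 := by
      rw [← hFx, ← hsplit, map_add, map_mul, eval_X]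
    have hHx : eval x H ∈ Ideal.span (x '' s) ^ (n + 1) := by
      refine mem_pow_of_mul_mem_pow h hi ?_
      rw [eq_neg_of_add_eq_zero_right hsum, neg_mem_iff, ← Ideal.mul_top (_ ^ _)]
      exact hG.eval_mem_pow_mul
        (fun j hj ↦ Ideal.subset_span ⟨j, mem_supported.mp hGs hj, rfl⟩) fun _ ↦ trivial
    have hHI : ∀ m, coeff m H ∈ Ideal.span (x '' insert i s) :=
      ih.coeff_mem hH hHs (Ideal.pow_right_mono hle _ hHx)
    rw [← Ideal.mul_top (Ideal.span (x '' s) ^ (n + 1))] at hHx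
    obtain ⟨K, hK, hKs, -, hKx⟩ := exists_isHomogeneous_eval_eq hHx
    have hGK := h (n + 1) (G + C (x i) * K) (hG.add (hK.C_mul _))
      (add_mem hGs (mul_mem ((supported R s).algebraMap_mem _) hKs))
      (by rw [map_add, map_mul, eval_C, hKx, hsum])
    intro m
    have hxi : x i ∈ Ideal.span (x '' insert i s) :=
      Ideal.subset_span ⟨i, Set.mem_insert i s, rfl⟩
    rw [← hsplit, coeff_add]
    refine Ideal.add_mem _ ?_ ?_
    · have := hle (hGK m)
      rw [coeff_add, coeff_C_mul] at this
      exact (Submodule.add_mem_iff_left _ (Ideal.mul_mem_right _ _ hxi)).mp this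
    · classical
      rw [coeff_X_mul']
      split_ifs
      exacts [hHI _, zero_mem _]

/-- A regular sequence is quasi-regular. -/
theorem quasiRegularInDegree_Iio {x : ℕ → R} {d : ℕ}
    (hx : ∀ i < d, ∀ r, x i * r ∈ Ideal.span (x '' Set.Iio i) → r ∈ Ideal.span (x '' Set.Iio i))
    (n : ℕ) : QuasiRegularInDegree x (Set.Iio d) n := by
  induction d generalizing n with
  | zero =>
    intro F _ hFs hFx m
    rw [Set.Iio_zero_eq_empty, supported_empty, Algebra.mem_bot] at hFs
    obtain ⟨r, rfl⟩ := hFs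
    rw [algebraMap_eq, eval_C] at hFx
    simp [hFx]
  | succ d ih =>
    rw [show Set.Iio (d + 1) = insert d (Set.Iio d) by ext; simp]
    exact quasiRegularInDegree_insert (ih fun i hi ↦ hx i (hi.trans d.lt_succ_self))
      (hx d d.lt_succ_self) n

end MvPolynomial

namespace Ideal

variable {R : Type*} [CommRing R] {p : ℕ} [Fact p.Prime] [CharP R p]

theorem frobeniusPower_eq_map (I : Ideal R) (e : ℕ) :
    I.frobeniusPower (p ^ e) = I.map (iterateFrobenius R p e) := rfl

/-- The tight closure consists exactly of the elements satisfying the defining condition. -/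
theorem mem_tightClosure_iff {I : Ideal R} {x : R} :
    x ∈ I.tightClosure p ↔ I.memTightClosure p x := by
  refine ⟨fun hx ↦ ?_, fun hx ↦ subset_span hx⟩
  induction hx using Submodule.span_induction with
  | mem x hx => exact hx
  | zero =>
    refine ⟨1, fun P hP h ↦ hP.1.1.ne_top ((eq_top_iff_one P).mpr h), 0, fun e _ ↦ ?_⟩
    simp [(Fact.out : p.Prime).ne_zero]
  | add x y _ _ hx hy =>
    obtain ⟨c, hc, N, hN⟩ := hx
    obtain ⟨c', hc', N', hN'⟩ := hy
    refine ⟨c * c', fun P hP h ↦ (hP.1.1.mem_or_mem h).elim (hc P hP) (hc' P hP), max N N',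
      fun e he ↦ ?_⟩
    have h₁ := mul_mem_left _ c' (hN e (le_of_max_le_left he))
    have h₂ := mul_mem_left _ c (hN' e (le_of_max_le_right he))
    convert add_mem h₁ h₂ using 1
    rw [add_pow_char_pow]
    ring
  | smul r x _ hx =>
    obtain ⟨c, hc, N, hN⟩ := hx
    refine ⟨c, hc, N, fun e he ↦ ?_⟩
    convert mul_mem_left _ (r ^ p ^ e) (hN e he) using 1
    rw [smul_eq_mul, mul_pow]
    ring

theorem mul_tightClosure_le (I J : Ideal R) :
    J * I.tightClosure p ≤ (J * I).tightClosure p := by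
  refine mul_le.mpr fun a ha y hy ↦ ?_
  obtain ⟨c, hc, N, hN⟩ := mem_tightClosure_iff.mp hy
  refine mem_tightClosure_iff.mpr ⟨c, hc, N, fun e he ↦ ?_⟩
  have h₁ := mul_mem_mul (mem_map_of_mem (iterateFrobenius R p e) ha) (hN e he)
  rw [frobeniusPower_eq_map, ← Ideal.map_mul] at h₁
  rw [frobeniusPower_eq_map]
  convert h₁ using 1
  rw [iterateFrobenius_def, mul_pow]
  ring

end Ideal

/-- **Huneke–Itoh intersection theorem for tight closure.** If `R` is a Noetherian ring of
prime characteristic `p` and `I` is generated by a regular sequence `x_1, …, x_d`, then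
for all `n ≥ 0` one has `I^n ∩ (I^{n+1})^* = I^n ⬝ I^*`. -/
theorem tight_intersection_theorem {R : Type*} [CommRing R] [IsNoetherianRing R]
    (p : ℕ) [Fact p.Prime] [CharP R p]
    (xs : List R) (hreg : RingTheory.Sequence.IsRegular R xs)
    (I : Ideal R) (hI : I = Ideal.ofList xs) (n : ℕ) :
    I ^ n ⊓ Ideal.tightClosure p (I ^ (n + 1)) = I ^ n * Ideal.tightClosure p I := by
  set x : ℕ → R := fun j ↦ xs.getD j 0
  have hIx : I = Ideal.span (x '' Set.Iio xs.length) := by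
    rw [hI, RingTheory.Sequence.span_getD_image_Iio xs le_rfl, List.take_length]
  refine le_antisymm ?_
    (le_inf Ideal.mul_le_left (by rw [pow_succ]; exact Ideal.mul_tightClosure_le I (I ^ n)))
  rintro y ⟨hyn, hy⟩
  obtain ⟨c, hc, N, hN⟩ := Ideal.mem_tightClosure_iff.mp hy
  have hyx : y ∈ Ideal.span (x '' Set.Iio xs.length) ^ n * ⊤ := by
    rw [Ideal.mul_top, ← hIx]
    exact hyn
  obtain ⟨F, hF, hFs, -, rfl⟩ := exists_isHomogeneous_eval_eq hyx
  have hFI : ∀ i ∈ F.vars, x i ∈ I := fun i hi ↦ by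
    rw [hIx]
    exact Ideal.subset_span ⟨i, mem_supported.mp hFs hi, rfl⟩
  refine hF.eval_mem_pow_mul hFI fun m ↦
    Ideal.mem_tightClosure_iff.mpr ⟨c, hc, N, fun e he ↦ ?_⟩
  set φ := iterateFrobenius R p e
  have hφx : (fun j ↦ (xs.map (· ^ p ^ e)).getD j 0) = φ ∘ x := by
    funext j
    have h₀ : (0 : R) = φ 0 := (map_zero φ).symm
    rw [Function.comp_apply, h₀]
    exact List.getD_map (n := j) xs 0 φ
  have hreg' : RingTheory.Sequence.IsWeaklyRegular R (xs.map (· ^ p ^ e)) :=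
    hreg.toIsWeaklyRegular.map_pow (pow_pos (Fact.out : p.Prime).pos e)
  have hQ : QuasiRegularInDegree (φ ∘ x) (Set.Iio xs.length) n := by
    rw [← hφx]
    exact quasiRegularInDegree_Iio
      (fun i hi r hr ↦ hreg'.mem_of_getD_mul_mem (by simpa using hi) hr) n
  have hImap : I.map φ = Ideal.span (φ ∘ x '' Set.Iio xs.length) := by
    rw [hIx, Ideal.map_span, Set.image_comp]
  have hmem := hQ.coeff_mem (F := C c * MvPolynomial.map φ F) ((hF.map φ).C_mul c)
    (mul_mem ((supported R _).algebraMap_mem c)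
      (mem_supported.mpr fun i hi ↦ mem_supported.mp hFs (vars_map F φ hi)))
    (by
      rw [eval_mul, eval_C, ← map_eval, ← hImap, ← Ideal.map_pow]
      exact hN e he) m
  rw [coeff_C_mul, coeff_map, ← hImap] at hmem
  exact hmem
end

section
/- Let R = F[[X,Y,Z]]/(X^2+Y^2+Z^2) where F is an infinite field of odd prime characteristic p. Then R is F-rational; equivalently, the parameter ideal I = (y,z) is tightly closed in R. -/
open MvPowerSeries

namespace MvPowerSeries

section Frobenius

variable {σ F : Type*} [Field F] {p : ℕ} [Fact p.Prime] [CharP F p]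

instance instCharP : CharP (MvPowerSeries σ F) p :=
  charP_of_injective_ringHom (f := (C : F →+* MvPowerSeries σ F)) C_injective p

theorem coeff_smul_pow_char_pow (r : MvPowerSeries σ F) (e : ℕ) (m : σ →₀ ℕ) :
    coeff (p ^ e • m) (r ^ p ^ e) = coeff m r ^ p ^ e := by
  rw [← map_iterateFrobenius_expand p (Fact.out : p.Prime).ne_zero, coeff_map,
    coeff_expand_smul, iterateFrobenius_def]

theorem coeff_pow_char_pow_of_not_dvd (r : MvPowerSeries σ F) (e : ℕ) {m : σ →₀ ℕ} {i : σ}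
    (h : ¬ p ^ e ∣ m i) : coeff m (r ^ p ^ e) = 0 := by
  rw [← map_iterateFrobenius_expand p (Fact.out : p.Prime).ne_zero, coeff_map,
    coeff_expand_of_not_dvd _ _ _ h, map_zero]

/-- Apply an additive map to the coefficients whose exponents are congruent to `d` modulo `q`. -/
noncomputable def cartier (l : F →+ F) (q : ℕ) (d : σ →₀ ℕ) :
    MvPowerSeries σ F →+ MvPowerSeries σ F where
  toFun s := fun m => l (coeff (q • m + d) s)
  map_zero' := funext fun m => by rw [coeff_zero, map_zero]; rfl
  map_add' s t := funext fun m => by rw [map_add, map_add]; rfl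

theorem coeff_cartier (l : F →+ F) (q : ℕ) (d m : σ →₀ ℕ) (s : MvPowerSeries σ F) :
    coeff m (cartier l q d s) = l (coeff (q • m + d) s) := rfl

theorem cartier_pow_mul (l : F →+ F) (e : ℕ) (hl : ∀ x y, l (x ^ p ^ e * y) = x * l y)
    (d : σ →₀ ℕ) (hd : ∀ i, d i < p ^ e) (r s : MvPowerSeries σ F) :
    cartier l (p ^ e) d (r ^ p ^ e * s) = r * cartier l (p ^ e) d s := by
  classical
  have hq : 0 < p ^ e := pow_pos (Fact.out : p.Prime).pos e
  ext m
  rw [coeff_cartier, coeff_mul, coeff_mul]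
  have key : ∑ x ∈ Finset.HasAntidiagonal.antidiagonal m,
        coeff x.1 r ^ p ^ e * coeff (p ^ e • x.2 + d) s =
      ∑ x ∈ Finset.HasAntidiagonal.antidiagonal (p ^ e • m + d),
        coeff x.1 (r ^ p ^ e) * coeff x.2 s := by
    refine Finset.sum_of_injOn (fun x => (p ^ e • x.1, p ^ e • x.2 + d)) ?_ ?_ ?_ ?_
    · rintro ⟨a, b⟩ - ⟨a', b'⟩ - h
      simpa [nsmul_right_inj hq.ne'] using h
    · rintro ⟨a, b⟩ h
      simp only [Finset.mem_coe,
        Finset.HasAntidiagonal.mem_antidiagonal] at h ⊢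
      rw [← h, smul_add, add_assoc]
    · rintro ⟨a, b⟩ h h'
      by_cases hdvd : ∀ i, p ^ e ∣ a i
      · exfalso
        apply h'
        rw [Finset.HasAntidiagonal.mem_antidiagonal] at h
        have hi : ∀ i, a i + b i = p ^ e * m i + d i := fun i => by
          simpa using DFunLike.congr_fun h i
        let a' : σ →₀ ℕ := a.mapRange (· / p ^ e) (by simp)
        have ha' : ∀ i, p ^ e * a' i = a i := fun i => by
          simpa [a'] using Nat.mul_div_cancel' (hdvd i)
        have hle : ∀ i, a' i ≤ m i := fun i => by
          have h1 := hi i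
          have h2 := hd i
          rw [← ha' i] at h1
          by_contra! hlt
          have := Nat.mul_le_mul_left (p ^ e) hlt
          rw [Nat.succ_eq_add_one, mul_add] at this
          omega
        refine ⟨(a', m - a'), ?_, ?_⟩
        · simpa using add_tsub_cancel_of_le (show a' ≤ m from hle)
        · ext i
          · simpa using ha' i
          · have h1 := hi i
            have h3 : p ^ e * (m i - a' i) + p ^ e * a' i = p ^ e * m i := by
              rw [← mul_add, Nat.sub_add_cancel (hle i)]
            have := ha' i
            simp only [Finsupp.coe_add, Finsupp.coe_smul, Finsupp.coe_tsub, Pi.add_apply,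
              Pi.smul_apply, Pi.sub_apply, smul_eq_mul]
            omega
      · push Not at hdvd
        obtain ⟨i, hi⟩ := hdvd
        rw [coeff_pow_char_pow_of_not_dvd r e hi, zero_mul]
    · rintro ⟨a, b⟩ -
      rw [coeff_smul_pow_char_pow]
  rw [← key, map_sum]
  exact Finset.sum_congr rfl fun x _ => by rw [hl, coeff_cartier]

end Frobenius

section Box

variable {σ R : Type*} [CommRing R]

/-- The ideal of power series all of whose monomials have some exponent at least `q`. -/
def boxIdeal (σ R : Type*) [CommRing R] (q : ℕ) : Ideal (MvPowerSeries σ R) where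
  carrier := {h | ∀ m : σ →₀ ℕ, (∀ i, m i < q) → coeff m h = 0}
  zero_mem' := by simp
  add_mem' ha hb m hm := by rw [map_add, ha m hm, hb m hm, add_zero]
  smul_mem' c h hh m hm := by
    classical
    rw [smul_eq_mul, coeff_mul]
    refine Finset.sum_eq_zero fun x hx => ?_
    rw [hh x.2 fun i => lt_of_le_of_lt ?_ (hm i), mul_zero]
    rw [Finset.HasAntidiagonal.mem_antidiagonal] at hx
    simp [← hx]

theorem mem_boxIdeal {q : ℕ} {h : MvPowerSeries σ R} :
    h ∈ boxIdeal σ R q ↔ ∀ m : σ →₀ ℕ, (∀ i, m i < q) → coeff m h = 0 := Iff.rfl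

theorem X_pow_mem_boxIdeal {q k : ℕ} (hk : q ≤ k) (s : σ) :
    (X s : MvPowerSeries σ R) ^ k ∈ boxIdeal σ R q := fun m hm =>
  X_pow_dvd_iff.1 dvd_rfl m ((hm s).trans_le hk)

/-- The subring of power series not involving the variable `s`. -/
def freeOf (R : Type*) [CommRing R] (s : σ) : Subring (MvPowerSeries σ R) where
  carrier := {a | ∀ m : σ →₀ ℕ, m s ≠ 0 → coeff m a = 0}
  zero_mem' := by simp
  one_mem' m hm := by
    classical
    rw [coeff_one, if_neg]
    rintro rfl
    exact hm rfl
  add_mem' ha hb m hm := by rw [map_add, ha m hm, hb m hm, add_zero]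
  neg_mem' ha m hm := by rw [map_neg, ha m hm, neg_zero]
  mul_mem' {a b} ha hb m hm := by
    classical
    rw [coeff_mul]
    refine Finset.sum_eq_zero fun x hx => ?_
    rw [Finset.HasAntidiagonal.mem_antidiagonal] at hx
    by_cases h : x.1 s = 0
    · rw [hb x.2 fun h' => hm ?_, mul_zero]
      simp [← hx, h, h']
    · rw [ha x.1 h, zero_mul]

theorem X_mem_freeOf {s t : σ} (h : t ≠ s) : (X t : MvPowerSeries σ R) ∈ freeOf R s := by
  classical
  intro m hm
  rw [coeff_X, if_neg]
  rintro rfl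
  simp [h] at hm

theorem coeff_single_add_X_pow_mul_of_mem_freeOf {s : σ} {a : MvPowerSeries σ R}
    (ha : a ∈ freeOf R s) {m : σ →₀ ℕ} (hm : m s = 0) (j k : ℕ) :
    coeff (Finsupp.single s k + m) (X s ^ j * a) = if j = k then coeff m a else 0 := by
  classical
  rw [X_pow_eq]
  split_ifs with h
  · rw [h, coeff_add_monomial_mul, one_mul]
  · rw [coeff_monomial_mul]
    split_ifs with h'
    · have h1 := h' s
      simp only [Finsupp.single_eq_same, Finsupp.coe_add, Pi.add_apply, hm, add_zero] at h1
      rw [ha, mul_zero]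
      simp only [Finsupp.coe_tsub, Finsupp.coe_add, Pi.sub_apply, Pi.add_apply,
        Finsupp.single_eq_same, hm]
      omega
    · rfl

end Box

section Linear

variable {σ K : Type*} [Field K]

theorem X_dvd_of_dvd_X_mul {s t : σ} (h : s ≠ t) {a : MvPowerSeries σ K}
    (ha : X s ∣ X t * a) : X s ∣ a := by
  rw [X_dvd_iff] at ha ⊢
  intro m hm
  have := ha (Finsupp.single t 1 + m) (by simp [hm, h])
  rwa [X, coeff_add_monomial_mul, one_mul] at this

theorem linear_dvd_of_dvd_X_mul {s t : σ} (h : s ≠ t) (c : K) {b : MvPowerSeries σ K}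
    (hb : X t + C c * X s ∣ X s * b) : X t + C c * X s ∣ b := by
  obtain ⟨a, ha⟩ := hb
  have : X s ∣ X t * a := ⟨b - C c * a, by linear_combination -ha⟩
  obtain ⟨a', rfl⟩ := X_dvd_of_dvd_X_mul h this
  refine ⟨a', mul_left_cancel₀ (show (X s : MvPowerSeries σ K) ≠ 0 from ?_) (ha.trans (by ring))⟩
  classical
  intro h0
  have := congrArg (coeff (Finsupp.single s 1)) h0
  simp at this

theorem linear_dvd_of_dvd_linear_mul {s t : σ} (h : s ≠ t) {c d : K} (hcd : c ≠ d)
    {b : MvPowerSeries σ K} (hb : X t + C c * X s ∣ (X t + C d * X s) * b) :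
    X t + C c * X s ∣ b := by
  apply linear_dvd_of_dvd_X_mul h
  have h1 : X t + C c * X s ∣ C (d - c) * (X s * b) := by
    have := dvd_sub hb (dvd_mul_right (X t + C c * X s) b)
    convert this using 1
    rw [map_sub]; ring
  have h2 : (C (d - c)⁻¹ : MvPowerSeries σ K) * C (d - c) = 1 := by
    rw [← map_mul, inv_mul_cancel₀ (sub_ne_zero.2 hcd.symm), map_one]
  have h3 := h1.mul_left (C (d - c)⁻¹)
  rwa [← mul_assoc, h2, one_mul] at h3

end Linear

end MvPowerSeries

theorem dvd_of_dvd_pow_mul_of_dvd_mul {A : Type*} [CommRing A] {u v : A}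
    (huv : ∀ b, u ∣ v * b → u ∣ b) (m : ℕ) {b : A} (h : u ∣ v ^ m * b) : u ∣ b := by
  induction m with
  | zero => simpa using h
  | succ m ih => exact ih (huv _ (by rwa [pow_succ', mul_assoc] at h))

theorem pow_dvd_of_pow_dvd_pow_mul {A : Type*} [CommRing A] [NoZeroDivisors A] {u v : A}
    (hu : u ≠ 0) (huv : ∀ b, u ∣ v * b → u ∣ b) (n m : ℕ) {b : A} (h : u ^ n ∣ v ^ m * b) : u ^ n ∣ b := by
  induction n generalizing b with
  | zero => simp
  | succ n ih =>
    obtain ⟨b, rfl⟩ := dvd_of_dvd_pow_mul_of_dvd_mul huv m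
      ((dvd_pow_self u n.succ_ne_zero).trans h)
    rw [pow_succ'] at h ⊢
    rw [mul_left_comm] at h
    exact mul_dvd_mul_left u (ih ((mul_dvd_mul_iff_left hu).1 h))

theorem exists_eq_add_of_mul_pow_mul_pow_eq {A : Type*} [CommRing A] [NoZeroDivisors A] {u v : A}
    (hu : u ≠ 0) (hv : v ≠ 0) (huv : ∀ b, u ∣ v * b → u ∣ b) (hvu : ∀ b, v ∣ u * b → v ∣ b)
    (n k : ℕ) {c a b : A} (h : c * (u ^ n * v ^ n) = u ^ (n + k) * a + v ^ (n + k) * b) :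
    ∃ a' b', c = u ^ k * a' + v ^ k * b' := by
  obtain ⟨b', rfl⟩ : u ^ n ∣ b := by
    refine pow_dvd_of_pow_dvd_pow_mul hu huv n (n + k) ⟨c * v ^ n - u ^ k * a, ?_⟩
    linear_combination -h
  obtain ⟨a', rfl⟩ : v ^ n ∣ a := by
    refine pow_dvd_of_pow_dvd_pow_mul hv hvu n (n + k) ⟨c * u ^ n - v ^ k * (u ^ n * b'), ?_⟩
    linear_combination -h
  refine ⟨a', b', mul_left_cancel₀ (mul_ne_zero (pow_ne_zero n hu) (pow_ne_zero n hv)) ?_⟩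
  linear_combination h

theorem exists_addMonoidHom_apply_mul_eq {E L : Type*} [Field E] [Field L] (f : E →+* L) {x : L}
    (hx : x ≠ 0) : ∃ l : L →+ E, l x = 1 ∧ ∀ a b, l (f a * b) = a * l b := by
  let := f.toAlgebra
  obtain ⟨l, hl⟩ := Module.Projective.exists_dual_eq_one E hx
  exact ⟨l.toAddMonoidHom, hl, fun a b => by
    simpa [Algebra.smul_def] using! l.map_smul a b⟩

namespace MvPowerSeries

section Quadric

/-- The quadratic form `X² + Y² + Z²` as a power series. -/
noncomputable def quadric (R : Type*) [CommRing R] : MvPowerSeries (Fin 3) R :=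
  X 0 ^ 2 + X 1 ^ 2 + X 2 ^ 2

/-- The coefficients of the quotient of `h` by `quadric R`, regarded as a monic polynomial
in `X 0`. -/
noncomputable def quadricQuotient {R : Type*} [CommRing R] (h : MvPowerSeries (Fin 3) R)
    (m : Fin 3 →₀ ℕ) : R :=
  coeff (m + Finsupp.single 0 2) h
    - (if _h1 : 2 ≤ m 1 then
        quadricQuotient h (m + Finsupp.single 0 2 - Finsupp.single 1 2) else 0)
    - (if _h2 : 2 ≤ m 2 then
        quadricQuotient h (m + Finsupp.single 0 2 - Finsupp.single 2 2) else 0)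
termination_by m 1 + m 2
decreasing_by
  all_goals
    simp
    omega

theorem exists_eq_quadric_mul_add {R : Type*} [CommRing R] (h : MvPowerSeries (Fin 3) R) :
    ∃ g, ∃ a ∈ freeOf R (0 : Fin 3), ∃ b ∈ freeOf R (0 : Fin 3),
      h = quadric R * g + (a + X 0 * b) := by
  classical
  let g : MvPowerSeries (Fin 3) R := quadricQuotient h
  have hle : ∀ (m : Fin 3 →₀ ℕ) (i : Fin 3), Finsupp.single i 2 ≤ m ↔ 2 ≤ m i := by
    simp
  have hr : ∀ m : Fin 3 →₀ ℕ, 2 ≤ m 0 → coeff m (h - quadric R * g) = 0 := by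
    intro m hm
    obtain ⟨m, rfl⟩ : ∃ m', m = m' + Finsupp.single 0 2 :=
      ⟨m - Finsupp.single 0 2, (tsub_add_cancel_of_le ((hle m 0).2 hm)).symm⟩
    have hg' : ∀ k, quadricQuotient h k = coeff k g := fun _ => rfl
    have hg : coeff m g = _ := quadricQuotient.eq_1 h m
    rw [map_sub, quadric, add_mul, add_mul, map_add, map_add, X_pow_eq, X_pow_eq, X_pow_eq,
      coeff_monomial_mul, coeff_monomial_mul, coeff_monomial_mul]
    simp only [hle, Finsupp.coe_add, Pi.add_apply, Finsupp.single_eq_same, one_mul,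
      add_tsub_cancel_right]
    rw [if_pos (by omega), hg]
    simp only [dite_eq_ite, hg']
    simp
    ring
  set r := h - quadric R * g
  let a : MvPowerSeries (Fin 3) R := fun m => if m 0 = 0 then coeff m r else 0
  let b : MvPowerSeries (Fin 3) R := fun m =>
    if m 0 = 0 then coeff (Finsupp.single 0 1 + m) r else 0
  have ha : ∀ m, coeff m a = if m 0 = 0 then coeff m r else 0 := fun _ => rfl
  have hb : ∀ m, coeff m b = if m 0 = 0 then coeff (Finsupp.single 0 1 + m) r else 0 :=
    fun _ => rfl
  refine ⟨g, a, fun m hm => by rw [ha, if_neg hm], b, fun m hm => by rw [hb, if_neg hm], ?_⟩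
  rw [← sub_eq_iff_eq_add']
  change r = _
  ext m
  rw [map_add, X, coeff_monomial_mul, ha, hb]
  obtain h0 | h1 | h2 : m 0 = 0 ∨ m 0 = 1 ∨ 2 ≤ m 0 := by omega
  · simp [h0]
  · have h3 : Finsupp.single 0 1 ≤ m := by simp [h1]
    simp [h1, add_tsub_cancel_of_le h3]
  · rw [hr m h2]
    have : m 0 - 1 ≠ 0 := by omega
    have h4 : m 0 ≠ 0 := by omega
    simp [this, h4]

theorem exists_eq_X_pow_mul_add {R : Type*} [CommRing R] {q : ℕ} {a : MvPowerSeries (Fin 3) R}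
    (ha : a ∈ freeOf R 0) (ha' : a ∈ boxIdeal (Fin 3) R q) :
    ∃ b c, a = X 1 ^ q * b + X 2 ^ q * c := by
  classical
  let s : MvPowerSeries (Fin 3) R := fun m => if q ≤ m 1 then coeff m a else 0
  have hs : ∀ m, coeff m s = if q ≤ m 1 then coeff m a else 0 := fun _ => rfl
  obtain ⟨b, hb⟩ : X 1 ^ q ∣ s := X_pow_dvd_iff.2 fun m hm => by rw [hs, if_neg (by omega)]
  obtain ⟨c, hc⟩ : X 2 ^ q ∣ a - s := X_pow_dvd_iff.2 fun m hm => by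
    rw [map_sub, hs]
    split_ifs with h
    · exact sub_self _
    · rw [sub_zero]
      by_cases h0 : m 0 = 0
      · exact ha' m (by intro i; fin_cases i <;> simp <;> omega)
      · exact ha m h0
  exact ⟨b, c, by rw [← hb, ← hc]; ring⟩

theorem coeff_eq_zero_of_mul_sq_add_sq_pow_mem_boxIdeal {F : Type*} [Field F] {p : ℕ}
    [Fact p.Prime] [CharP F p] (hp : p ≠ 2) {e n : ℕ} (hn : p ^ e = 2 * n + 1)
    {a : MvPowerSeries (Fin 3) F} (ha : a ∈ freeOf F 0)
    (h : a * (X 1 ^ 2 + X 2 ^ 2) ^ n ∈ boxIdeal (Fin 3) F (p ^ e))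
    {m : Fin 3 →₀ ℕ} (hm : m.degree ≤ n) : coeff m a = 0 := by
  let K := AlgebraicClosure F
  have : CharP K p := charP_of_injective_algebraMap (algebraMap F K).injective p
  have h2 : (2 : K) ≠ 0 := Ring.two_ne_zero (by rwa [ringChar.eq K p])
  obtain ⟨i, hi⟩ := IsAlgClosed.exists_pow_nat_eq (-1 : K) (n := 2) (by norm_num)
  have hi0 : i ≠ 0 := by rintro rfl; simp at hi
  have hii : i ≠ -i := fun h => mul_ne_zero h2 hi0 (by linear_combination h)
  have hfree : (X 1 ^ 2 + X 2 ^ 2 : MvPowerSeries (Fin 3) F) ∈ freeOf F 0 :=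
    add_mem (pow_mem (X_mem_freeOf (by decide)) 2) (pow_mem (X_mem_freeOf (by decide)) 2)
  obtain ⟨b, c, hbc⟩ := exists_eq_X_pow_mul_add
    (mul_mem ha (pow_mem hfree n)) h
  let u : MvPowerSeries (Fin 3) K := X 1 + C i * X 2
  let v : MvPowerSeries (Fin 3) K := X 1 + C (-i) * X 2
  have hlin : ∀ c : K, (X 1 + C c * X 2 : MvPowerSeries (Fin 3) K) ≠ 0 := fun c h0 => by
    classical
    have := congrArg (coeff (Finsupp.single 1 1)) h0
    simp [coeff_X, Finsupp.single_left_inj] at this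
  have hC : (C i : MvPowerSeries (Fin 3) K) ^ 2 = -1 := by rw [← map_pow, hi, map_neg, map_one]
  have huv : u * v = X 1 ^ 2 + X 2 ^ 2 := by
    simp only [u, v, map_neg]
    linear_combination -(X 2 : MvPowerSeries (Fin 3) K) ^ 2 * hC
  have hhalf : (C (2⁻¹) : MvPowerSeries (Fin 3) K) * 2 = 1 := by
    rw [← map_ofNat C 2, ← map_mul, inv_mul_cancel₀ h2, map_one]
  have hX1 : (X 1 : MvPowerSeries (Fin 3) K) = C 2⁻¹ * (u + v) := by
    simp only [u, v, map_neg]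
    linear_combination -(X 1 : MvPowerSeries (Fin 3) K) * hhalf
  have hX2 : (X 2 : MvPowerSeries (Fin 3) K) = C 2⁻¹ * C i * (v - u) := by
    simp only [u, v, map_neg]
    linear_combination -(X 2 : MvPowerSeries (Fin 3) K) * hhalf
      - (X 2 : MvPowerSeries (Fin 3) K) * C 2⁻¹ * (-2) * hC
  have hmap := congrArg (map (algebraMap F K)) hbc
  simp only [map_mul, map_add, map_pow, map_X] at hmap
  rw [← huv, hX1, hX2, mul_pow (C 2⁻¹) (u + v), mul_pow _ (v - u),
    add_pow_char_pow (p := p), sub_pow_char_pow (p := p), hn,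
    mul_pow u v] at hmap
  obtain ⟨a', b', hab⟩ := exists_eq_add_of_mul_pow_mul_pow_eq (hlin i) (hlin (-i))
    (fun _ => linear_dvd_of_dvd_linear_mul (by decide) hii)
    (fun _ => linear_dvd_of_dvd_linear_mul (by decide) hii.symm) n (n + 1)
    (c := map (algebraMap F K) a)
    (a := C 2⁻¹ ^ (2 * n + 1) * map (algebraMap F K) b
      - (C 2⁻¹ * C i) ^ (2 * n + 1) * map (algebraMap F K) c)
    (b := C 2⁻¹ ^ (2 * n + 1) * map (algebraMap F K) b
      + (C 2⁻¹ * C i) ^ (2 * n + 1) * map (algebraMap F K) c)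
    (by rw [show n + (n + 1) = 2 * n + 1 by ring]; linear_combination hmap)
  have hord : ∀ (w z : MvPowerSeries (Fin 3) K), constantCoeff w = 0 →
      coeff m (w ^ (n + 1) * z) = 0 := fun w z hw => by
    refine coeff_of_lt_order (lt_of_lt_of_le ?_ ((le_order_pow_of_constantCoeff_eq_zero
      (n + 1) hw).trans (le_self_add.trans le_order_mul)))
    exact_mod_cast Nat.lt_succ_of_le hm
  have := congrArg (coeff m) hab
  rw [map_add, hord _ _ (by simp), hord _ _ (by simp), add_zero, coeff_map] at this
  exact (_root_.map_eq_zero _).1 this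

theorem quadric_pow_eq_sum {F : Type*} [Field F] {p : ℕ} [Fact p.Prime] [CharP F p] (e : ℕ) :
    quadric F ^ (p ^ e - 1) = ∑ i ∈ Finset.range (p ^ e),
      (X 0 ^ 2) ^ i * (-(X 1 ^ 2 + X 2 ^ 2)) ^ (p ^ e - 1 - i) := by
  have hq : quadric F = X 0 ^ 2 - -(X 1 ^ 2 + X 2 ^ 2) := by rw [quadric]; ring
  have h0 : quadric F ≠ 0 := fun h => by
    classical
    have := congrArg (coeff (Finsupp.single 0 2)) h
    simp [quadric, coeff_X_pow, Finsupp.single_left_inj] at this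
  refine mul_right_cancel₀ h0 ?_
  rw [pow_sub_one_mul (pow_ne_zero e (Fact.out : p.Prime).ne_zero), hq, geom_sum₂_mul,
    sub_pow_char_pow]

theorem mul_sq_add_sq_pow_mem_boxIdeal {F : Type*} [Field F] {p : ℕ}
    [Fact p.Prime] [CharP F p] {e n : ℕ} (hn : p ^ e = 2 * n + 1)
    {a b : MvPowerSeries (Fin 3) F} (ha : a ∈ freeOf F 0) (hb : b ∈ freeOf F 0)
    (h : (a + X 0 * b) * quadric F ^ (p ^ e - 1) ∈ boxIdeal (Fin 3) F (p ^ e)) :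
    a * (X 1 ^ 2 + X 2 ^ 2) ^ n ∈ boxIdeal (Fin 3) F (p ^ e) := by
  classical
  have hfree : (-(X 1 ^ 2 + X 2 ^ 2) : MvPowerSeries (Fin 3) F) ∈ freeOf F 0 :=
    neg_mem (add_mem (pow_mem (X_mem_freeOf (by decide)) 2)
      (pow_mem (X_mem_freeOf (by decide)) 2))
  suffices hs : a * (-(X 1 ^ 2 + X 2 ^ 2)) ^ n ∈ boxIdeal (Fin 3) F (p ^ e) by
    have := Ideal.mul_mem_right ((-1) ^ n) _ hs
    rwa [mul_assoc, ← mul_pow, mul_neg_one, neg_neg] at this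
  intro m hm
  by_cases h0 : m 0 = 0
  swap
  · exact mul_mem ha (pow_mem hfree n) m h0
  have h1 := h (Finsupp.single 0 (2 * n) + m) (fun i => by
    by_cases hi : i = 0
    · subst hi; simp [h0, hn]
    · simpa [Finsupp.single_apply, Ne.symm hi] using hm i)
  rw [quadric_pow_eq_sum, Finset.mul_sum, map_sum, Finset.sum_eq_single n] at h1
  · rw [show (a + X 0 * b) * ((X 0 ^ 2) ^ n * (-(X 1 ^ 2 + X 2 ^ 2)) ^ (p ^ e - 1 - n)) =
      X 0 ^ (2 * n) * (a * (-(X 1 ^ 2 + X 2 ^ 2)) ^ (p ^ e - 1 - n)) +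
      X 0 ^ (2 * n + 1) * (b * (-(X 1 ^ 2 + X 2 ^ 2)) ^ (p ^ e - 1 - n)) by ring, map_add,
      coeff_single_add_X_pow_mul_of_mem_freeOf (mul_mem ha (pow_mem hfree _)) h0,
      coeff_single_add_X_pow_mul_of_mem_freeOf (mul_mem hb (pow_mem hfree _)) h0,
      if_pos rfl, if_neg (by omega), add_zero, show p ^ e - 1 - n = n by omega] at h1
    exact h1
  · intro j _ hj
    rw [show (a + X 0 * b) * ((X 0 ^ 2) ^ j * (-(X 1 ^ 2 + X 2 ^ 2)) ^ (p ^ e - 1 - j)) =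
      X 0 ^ (2 * j) * (a * (-(X 1 ^ 2 + X 2 ^ 2)) ^ (p ^ e - 1 - j)) +
      X 0 ^ (2 * j + 1) * (b * (-(X 1 ^ 2 + X 2 ^ 2)) ^ (p ^ e - 1 - j)) by ring, map_add,
      coeff_single_add_X_pow_mul_of_mem_freeOf (mul_mem ha (pow_mem hfree _)) h0,
      coeff_single_add_X_pow_mul_of_mem_freeOf (mul_mem hb (pow_mem hfree _)) h0,
      if_neg (by omega), if_neg (by omega), add_zero]
  · intro hj
    exact absurd (Finset.mem_range.2 (by omega)) hj

theorem quadric_dvd_of_forall_mul_mem_boxIdeal {F : Type*} [Field F] {p : ℕ}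
    [Fact p.Prime] [CharP F p] (hp : p ≠ 2) (N : ℕ) {c : MvPowerSeries (Fin 3) F}
    (hc : ∀ e, N ≤ e → c * quadric F ^ (p ^ e - 1) ∈ boxIdeal (Fin 3) F (p ^ e)) :
    quadric F ∣ c := by
  have key : ∀ a ∈ freeOf F (0 : Fin 3), ∀ b ∈ freeOf F (0 : Fin 3),
      (∀ e, N ≤ e → (a + X 0 * b) * quadric F ^ (p ^ e - 1) ∈ boxIdeal (Fin 3) F (p ^ e)) →
      a = 0 := by
    intro a ha b hb h
    ext m
    have hp' : p.Prime := Fact.out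
    obtain ⟨n, hn⟩ : Odd (p ^ (N + 2 * m.degree)) := (hp'.odd_of_ne_two hp).pow
    refine coeff_eq_zero_of_mul_sq_add_sq_pow_mem_boxIdeal hp hn ha
      (mul_sq_add_sq_pow_mem_boxIdeal hn ha hb (h _ (by omega))) ?_
    have := (N + 2 * m.degree).lt_pow_self hp'.one_lt
    omega
  have hq : ∀ e, quadric F ^ p ^ e ∈ boxIdeal (Fin 3) F (p ^ e) := fun e => by
    rw [quadric, add_pow_char_pow, add_pow_char_pow, ← pow_mul, ← pow_mul, ← pow_mul]
    exact add_mem (add_mem (X_pow_mem_boxIdeal (by omega) _) (X_pow_mem_boxIdeal (by omega) _))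
      (X_pow_mem_boxIdeal (by omega) _)
  have hq' : ∀ e, quadric F * quadric F ^ (p ^ e - 1) = quadric F ^ p ^ e := fun e =>
    mul_pow_sub_one (pow_ne_zero e (Fact.out : p.Prime).ne_zero) _
  obtain ⟨g, a, ha, b, hb, rfl⟩ := exists_eq_quadric_mul_add c
  have hr : ∀ e, N ≤ e →
      (a + X 0 * b) * quadric F ^ (p ^ e - 1) ∈ boxIdeal (Fin 3) F (p ^ e) := fun e he => by
    convert sub_mem (hc e he) (Ideal.mul_mem_left _ g (hq e)) using 1
    rw [← hq']; ring
  obtain rfl := key a ha b hb hr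
  obtain rfl : b = 0 := by
    have hfree : (-(X 1 ^ 2 + X 2 ^ 2) : MvPowerSeries (Fin 3) F) ∈ freeOf F 0 :=
      neg_mem (add_mem (pow_mem (X_mem_freeOf (by decide)) 2)
        (pow_mem (X_mem_freeOf (by decide)) 2))
    have h0 := key _ (mul_mem hfree hb) 0 (zero_mem _) fun e he => by
      convert sub_mem (Ideal.mul_mem_left _ (X 0) (hr e he)) (Ideal.mul_mem_left _ b (hq e))
        using 1
      rw [← hq', show (-(X 1 ^ 2 + X 2 ^ 2) : MvPowerSeries (Fin 3) F) = X 0 ^ 2 - quadric F by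
        rw [quadric]; ring]
      ring
    refine (mul_eq_zero.1 h0).resolve_left fun h => ?_
    classical
    have := congrArg (coeff (Finsupp.single 1 2)) h
    simp [coeff_X_pow, Finsupp.single_left_inj] at this
  exact ⟨g, by ring⟩

/-- Fedder's criterion for tight closure in a hypersurface ring. -/
theorem mem_of_mul_pow_mem_frobeniusPower {σ F : Type*} [Field F] {p : ℕ} [Fact p.Prime]
    [CharP F p]
    {f c : MvPowerSeries (σ) F} {e : ℕ}
    (hc : c * f ^ (p ^ e - 1) ∉ boxIdeal (σ) F (p ^ e))
    {J : Ideal (MvPowerSeries (σ) F ⧸ Ideal.span {f})} {x : MvPowerSeries (σ) F}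
    (hx : Ideal.Quotient.mk (Ideal.span {f}) c * Ideal.Quotient.mk (Ideal.span {f}) x ^ p ^ e ∈
      J.frobeniusPower (p ^ e)) :
    Ideal.Quotient.mk (Ideal.span {f}) x ∈ J := by
  let π := Ideal.Quotient.mk (Ideal.span {f})
  obtain ⟨d, hd, hd0⟩ : ∃ d : σ →₀ ℕ, (∀ i, d i < p ^ e) ∧
      coeff d (c * f ^ (p ^ e - 1)) ≠ 0 := by
    simpa [mem_boxIdeal] using hc
  obtain ⟨l, hl1, hl⟩ := exists_addMonoidHom_apply_mul_eq (iterateFrobenius F p e) hd0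
  simp only [iterateFrobenius_def] at hl
  let ψ : MvPowerSeries (σ) F →+ MvPowerSeries (σ) F := cartier l (p ^ e) d
  have hψ : ∀ r s, ψ (r ^ p ^ e * s) = r * ψ s := cartier_pow_mul l e hl d hd
  have hker : ∀ {s t}, π s = π t → π (ψ (f ^ (p ^ e - 1) * t)) ∈ J →
      π (ψ (f ^ (p ^ e - 1) * s)) ∈ J := by
    intro s t hst h
    obtain ⟨g, hg⟩ := Ideal.mem_span_singleton.1 (Ideal.Quotient.eq.1 hst)
    suffices hs : π (ψ (f ^ (p ^ e - 1) * s)) = π (ψ (f ^ (p ^ e - 1) * t)) by rwa [hs]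
    refine Ideal.Quotient.eq.2 (Ideal.mem_span_singleton.2 ⟨ψ g, ?_⟩)
    rw [← map_sub, ← mul_sub, hg, ← mul_assoc,
      pow_sub_one_mul (pow_ne_zero e (Fact.out : p.Prime).ne_zero), hψ]
  have hmem : ∀ y ∈ J.frobeniusPower (p ^ e), ∀ t s, π s = y →
      π (ψ (f ^ (p ^ e - 1) * (t * s))) ∈ J := by
    intro y hy
    induction hy using Submodule.span_induction with
    | mem y hy =>
      obtain ⟨j, hj, rfl⟩ := hy
      obtain ⟨j, rfl⟩ := Ideal.Quotient.mk_surjective j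
      intro t s hs
      refine hker (t := t * j ^ p ^ e) (by simp [hs, π]) ?_
      rw [← mul_assoc, mul_comm, hψ, map_mul]
      exact J.mul_mem_right _ hj
    | zero =>
      intro t s hs
      exact hker (t := 0) (by simp [hs]) (by simp)
    | add y z _ _ hy hz =>
      intro t s hs
      obtain ⟨y, rfl⟩ := Ideal.Quotient.mk_surjective y
      obtain ⟨z, rfl⟩ := Ideal.Quotient.mk_surjective z
      refine hker (t := t * y + t * z) (by simp [hs, π, mul_add]) ?_
      rw [mul_add, map_add, map_add]
      exact add_mem (hy t y rfl) (hz t z rfl)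
    | smul r y _ hy =>
      intro t s hs
      obtain ⟨r, rfl⟩ := Ideal.Quotient.mk_surjective r
      obtain ⟨y, rfl⟩ := Ideal.Quotient.mk_surjective y
      exact hker (t := t * r * y) (by simp [hs, π, mul_assoc]) (hy _ y rfl)
  have h1 := hmem _ hx 1 (c * x ^ p ^ e) (by simp [π])
  rw [show f ^ (p ^ e - 1) * (1 * (c * x ^ p ^ e)) = x ^ p ^ e * (c * f ^ (p ^ e - 1)) by ring, hψ,
    map_mul] at h1
  have hu : IsUnit (ψ (c * f ^ (p ^ e - 1))) := by
    rw [isUnit_iff_constantCoeff, ← coeff_zero_eq_constantCoeff_apply]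
    simp [ψ, coeff_cartier, hl1]
  exact (Ideal.mul_unit_mem_iff_mem J (hu.map π)).1 h1

end Quadric

end MvPowerSeries

theorem Ideal.tightClosure_eq_of_forall {R : Type*} [CommRing R] {p : ℕ} {J : Ideal R}
    (h : ∀ x, J.memTightClosure p x → x ∈ J) : J.tightClosure p = J := by
  refine le_antisymm (Ideal.span_le.2 h) fun x hx => Ideal.subset_span ⟨1, ?_, 0, fun e _ => ?_⟩
  · intro P hP h1
    exact hP.1.1.ne_top ((Ideal.eq_top_iff_one P).2 h1)
  · rw [one_mul]
    exact Ideal.subset_span ⟨x, hx, rfl⟩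

theorem Ideal.tightClosure_quadric {F : Type*} [Field F] {p : ℕ} [Fact p.Prime] [CharP F p]
    (hp : p ≠ 2) (J : Ideal (MvPowerSeries (Fin 3) F ⧸ Ideal.span {quadric F})) :
    J.tightClosure p = J := by
  refine Ideal.tightClosure_eq_of_forall fun x ⟨c, hc, N, h⟩ => ?_
  obtain ⟨c, rfl⟩ := Ideal.Quotient.mk_surjective c
  obtain ⟨x, rfl⟩ := Ideal.Quotient.mk_surjective x
  have hne : Nontrivial (MvPowerSeries (Fin 3) F ⧸ Ideal.span {quadric F}) := by
    rw [Ideal.Quotient.nontrivial_iff, Ne, Ideal.span_singleton_eq_top,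
      isUnit_iff_constantCoeff]
    simp [quadric]
  have hdvd : ¬ quadric F ∣ c := fun hd => by
    obtain ⟨P, hP⟩ := Ideal.nonempty_minimalPrimes
      (bot_ne_top (α := Ideal (MvPowerSeries (Fin 3) F ⧸ Ideal.span {quadric F})))
    refine hc P hP ?_
    rw [Ideal.Quotient.eq_zero_iff_mem.2 (Ideal.mem_span_singleton.2 hd)]
    exact zero_mem P
  obtain ⟨e, he, hbox⟩ : ∃ e, N ≤ e ∧
      c * quadric F ^ (p ^ e - 1) ∉ boxIdeal (Fin 3) F (p ^ e) := by
    by_contra! hcon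
    exact hdvd (quadric_dvd_of_forall_mul_mem_boxIdeal hp N hcon)
  exact mem_of_mul_pow_mem_frobeniusPower hbox (h e he)

/-- **`F`-rationality of the quadric hypersurface.** Let
`R = F[[X,Y,Z]]/(X² + Y² + Z²)` where `F` is an infinite field of odd prime
characteristic `p`. Then `R` is `F`-rational (every ideal generated by a system of
parameters, i.e. by two elements generating an ideal with radical the maximal ideal
`m = (x,y,z)`, is tightly closed); equivalently, the parameter ideal `I = (y, z)` is
tightly closed in `R`. -/
theorem quadric_is_F_rational (F : Type*) [Field F] [Infinite F]
    (p : ℕ) [Fact p.Prime] [CharP F p] (hp : p ≠ 2)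
    (Q : Ideal (MvPowerSeries (Fin 3) F))
    (hQ : Q = Ideal.span {(X 0 : MvPowerSeries (Fin 3) F) ^ 2 + X 1 ^ 2 + X 2 ^ 2})
    (I m : Ideal (MvPowerSeries (Fin 3) F ⧸ Q))
    (hI : I = Ideal.span {Ideal.Quotient.mk Q (X 1), Ideal.Quotient.mk Q (X 2)})
    (hm : m = Ideal.span {Ideal.Quotient.mk Q (X 0), Ideal.Quotient.mk Q (X 1),
      Ideal.Quotient.mk Q (X 2)}) :
    Ideal.tightClosure p I = I ∧
      ∀ J : Ideal (MvPowerSeries (Fin 3) F ⧸ Q),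
        (∃ a b : MvPowerSeries (Fin 3) F ⧸ Q, J = Ideal.span {a, b} ∧ J.radical = m) →
        Ideal.tightClosure p J = J := by
  have h : ∀ J : Ideal (MvPowerSeries (Fin 3) F ⧸ Q), Ideal.tightClosure p J = J := by
    subst hQ
    exact fun J => Ideal.tightClosure_quadric hp J
  exact ⟨h I, fun J _ => h J⟩
end

section
/- Let R = F[[X,Y,Z]]/(X^N+Y^N+Z^N), N ≥ 3, with F an infinite field of prime characteristic p, p ∤ N. Let I = (y,z) and m = (x,y,z). Then for all k ≥ 1, the tight closure (I^k)^* equals m^{k+1} + I^k. -/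
set_option synthInstance.maxHeartbeats 1000000
open MvPowerSeries

namespace Polynomial

theorem coeff_sum_X_pow_mul_expand {K : Type*} [CommSemiring K] {q : ℕ} (U : ℕ → K[X]) {l : ℕ}
    (hl : l < q) (j : ℕ) :
    (∑ r ∈ Finset.range q, X ^ r * expand K q (U r)).coeff (q * j + l) = (U l).coeff j := by
  rw [finsetSum_coeff, Finset.sum_eq_single_of_mem l (Finset.mem_range.2 hl)]
  · rw [coeff_X_pow_mul, mul_comm q, coeff_expand_mul (by omega)]
  · intro r hr hrl
    rw [Finset.mem_range] at hr
    rw [coeff_X_pow_mul', coeff_expand (by omega)]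
    split_ifs with h1 h2
    · exfalso
      obtain ⟨t, ht⟩ := h2
      have h3 : q * j + l = q * t + r := by omega
      have := congrArg (· % q) h3
      simp [Nat.mod_eq_of_lt hl, Nat.mod_eq_of_lt hr] at this
      exact hrl this.symm
    · rfl
    · rfl

theorem exists_sum_X_pow_mul_expand {K : Type*} [CommSemiring K] {q m : ℕ} (g : K[X])
    (hg : g.natDegree < m * q) :
    ∃ c : ℕ → K[X], (∀ l, (c l).degree < m) ∧
      g = ∑ l ∈ Finset.range q, X ^ l * expand K q (c l) := by
  have hq : 0 < q := Nat.pos_of_ne_zero fun h => by simp [h] at hg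
  refine ⟨fun l => ∑ j ∈ Finset.range m, monomial j (g.coeff (q * j + l)), fun l => ?_, ?_⟩
  · rw [← mem_degreeLT]
    refine Submodule.sum_mem _ fun j hj => ?_
    rw [mem_degreeLT]
    exact (degree_monomial_le _ _).trans_lt (by exact_mod_cast Finset.mem_range.1 hj)
  · ext n
    conv_rhs => rw [← Nat.div_add_mod n q]
    rw [coeff_sum_X_pow_mul_expand _ (Nat.mod_lt _ hq), finsetSum_coeff]
    simp only [coeff_monomial, Finset.sum_ite_eq', Finset.mem_range, Nat.div_add_mod]
    split_ifs with h
    · rfl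
    · apply coeff_eq_zero_of_natDegree_lt
      rw [not_lt, Nat.le_div_iff_mul_le hq] at h
      omega

theorem card_roots_toFinset_X_pow_add_one {K : Type*} [Field K] [IsAlgClosed K] [DecidableEq K]
    {N : ℕ} (hN : (N : K) ≠ 0) : (X ^ N + 1 : K[X]).roots.toFinset.card = N := by
  have hN0 : N ≠ 0 := by rintro rfl; simp at hN
  have he : (X ^ N + 1 : K[X]) = X ^ N - C (-1) := by simp
  have hsep : (X ^ N + 1 : K[X]).Separable := by
    rw [he]
    exact separable_X_pow_sub_C _ hN (by simp)
  rw [Multiset.toFinset_card_of_nodup (nodup_roots hsep), IsAlgClosed.card_roots_eq_natDegree, he,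
    natDegree_X_pow_sub_C]

/-- If `g` is divisible by a high power of `X ^ N + 1`, has degree less than `N * q`, and the
exponents of `f ^ q * g` are all small modulo `q`, then `f` or `g` vanishes. -/
theorem eq_zero_of_coeff_pow_mul_eq_zero {K : Type*} [Field K] [IsAlgClosed K] (p : ℕ)
    [Fact p.Prime] [CharP K p] {e N s M : ℕ} (hpN : ¬ p ∣ N) {f g : K[X]} (hf : f ≠ 0)
    (hdeg : g.natDegree < N * p ^ e) (hMs : M < s) (hs : s ≤ p ^ e) (hdvd : (X ^ N + 1) ^ s ∣ g)
    (hfg : ∀ n, M < n % p ^ e → (f ^ p ^ e * g).coeff n = 0) : g = 0 := by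
  classical
  set q := p ^ e with hq
  obtain ⟨c, hc, hgc⟩ := exists_sum_X_pow_mul_expand g hdeg
  have hφ : expand K q (f.map (iterateFrobenius K p e)) = f ^ q := by
    rw [← map_expand, map_iterateFrobenius_expand]
  have hφ0 : f.map (iterateFrobenius K p e) ≠ 0 := by
    rwa [Ne, Polynomial.map_eq_zero]
  have hprod : f ^ q * g =
      ∑ l ∈ Finset.range q, X ^ l * expand K q (f.map (iterateFrobenius K p e) * c l) := by
    rw [hgc, Finset.mul_sum]
    refine Finset.sum_congr rfl fun l _ => ?_
    rw [map_mul, hφ]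
    ring
  have hcM : ∀ l, M < l → l < q → c l = 0 := by
    intro l hl hlq
    have : f.map (iterateFrobenius K p e) * c l = 0 := by
      ext j
      rw [← coeff_sum_X_pow_mul_expand
        (fun l => f.map (iterateFrobenius K p e) * c l) hlq j, ← hprod, coeff_zero]
      exact hfg _ (by rwa [Nat.mul_add_mod, Nat.mod_eq_of_lt hlq])
    exact (mul_eq_zero.1 this).resolve_left hφ0
  have hroot : ∀ ζ : K, ζ ^ N + 1 = 0 → ∀ l < q, (c l).eval (ζ ^ q) = 0 := by
    intro ζ hζ l hl
    set h : K[X] := ∑ l ∈ Finset.range q, C ((c l).eval (ζ ^ q)) * X ^ l with hh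
    have h1 : (X - C ζ) ^ s ∣ g - h := by
      refine (pow_dvd_pow _ hs).trans ?_
      rw [hgc, hh, ← Finset.sum_sub_distrib]
      refine Finset.dvd_sum fun l _ => ?_
      have h2 : X - C (ζ ^ q) ∣ c l - C ((c l).eval (ζ ^ q)) := by
        rw [dvd_iff_isRoot]; simp
      have h3 := _root_.map_dvd (expand K q) h2
      simp only [map_sub, expand_X, expand_C] at h3
      rw [hq, sub_pow_expChar_pow, ← C_pow, ← hq]
      rw [show X ^ l * expand K q (c l) - C ((c l).eval (ζ ^ q)) * X ^ l =
        (expand K q (c l) - C ((c l).eval (ζ ^ q))) * X ^ l by ring]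
      exact h3.mul_right _
    have h4 : (X - C ζ) ^ s ∣ g := by
      refine (pow_dvd_pow_of_dvd ?_ s).trans hdvd
      rw [dvd_iff_isRoot]
      simpa using hζ
    have h5 : (X - C ζ) ^ s ∣ h := by
      have := dvd_sub h4 h1
      rwa [sub_sub_cancel] at this
    have h6 : h = 0 := by
      by_contra h0
      have h7 := natDegree_le_of_dvd h5 h0
      rw [natDegree_pow, natDegree_X_sub_C, mul_one] at h7
      have h8 : h.natDegree ≤ M := by
        refine natDegree_sum_le_of_forall_le _ _ fun l hl => ?_
        rcases le_or_gt l M with hlM | hlM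
        · exact (natDegree_C_mul_X_pow_le _ _).trans hlM
        · simp [hcM l hlM (Finset.mem_range.1 hl)]
      omega
    have h9 : h.coeff l = 0 := by rw [h6, coeff_zero]
    rw [hh, finsetSum_coeff] at h9
    simpa [coeff_C_mul, coeff_X_pow, hl] using h9
  have hNK : (N : K) ≠ 0 := by rwa [Ne, CharP.cast_eq_zero_iff K p]
  have hN0 : N ≠ 0 := by rintro rfl; simp at hNK
  have hc0 : ∀ l < q, c l = 0 := by
    intro l hl
    set S := (X ^ N + 1 : K[X]).roots.toFinset.image (iterateFrobenius K p e) with hS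
    have hcard : S.card = N := by
      rw [hS, Finset.card_image_of_injective _ (iterateFrobenius K p e).injective,
        card_roots_toFinset_X_pow_add_one hNK]
    refine eq_zero_of_degree_lt_of_eval_finset_eq_zero S (by rw [hcard]; exact hc l) ?_
    intro x hx
    obtain ⟨ζ, hζ, rfl⟩ := Finset.mem_image.1 hx
    rw [Multiset.mem_toFinset, mem_roots'] at hζ
    rw [iterateFrobenius_def]
    exact hroot ζ (by simpa using hζ.2) l hl
  rw [hgc]
  exact Finset.sum_eq_zero fun l hl => by simp [hc0 l (Finset.mem_range.1 hl)]

end Polynomial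

namespace MvPowerSeries

theorem mem_span_X_pow_of_coeff_eq_zero {F : Type*} [CommRing F] (n : ℕ) :
    ∀ f : MvPowerSeries (Fin 2) F, (∀ d, d 0 + d 1 < n → coeff d f = 0) →
      f ∈ (Ideal.span {X 0, X 1} : Ideal (MvPowerSeries (Fin 2) F)) ^ n := by
  induction n with
  | zero => intro f _; simp
  | succ n ih =>
    intro f hf
    classical
    set f₀ : MvPowerSeries (Fin 2) F := fun d => if d 0 = 0 then 0 else coeff d f with hf₀
    have hc₀ : ∀ d, coeff d f₀ = if d 0 = 0 then 0 else coeff d f := fun d => rfl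
    obtain ⟨g, hg⟩ : X 0 ∣ f₀ := X_dvd_iff.2 fun m hm => by simp [hc₀, hm]
    obtain ⟨h, hh⟩ : X 1 ∣ f - f₀ := X_dvd_iff.2 fun m hm => by
      rw [map_sub, hc₀]
      split_ifs with h0
      · rw [hf m (by omega), sub_zero]
      · rw [sub_self]
    have key : ∀ (s : Fin 2) (u : MvPowerSeries (Fin 2) F) (d : Fin 2 →₀ ℕ),
        coeff d u = coeff (d + Finsupp.single s 1) (X s * u) := fun s u d => by
      rw [mul_comm, X, coeff_add_mul_monomial, mul_one]
    have hg' := ih g fun d hd => by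
      rw [key 0, ← hg, hc₀, hf _ (by simp; omega), ite_self]
    have hh' := ih h fun d hd => by
      rw [key 1, ← hh, map_sub, hc₀, hf _ (by simp; omega), ite_self, sub_zero]
    have hfe : f = X 0 * g + X 1 * h := by rw [← hg, ← hh]; ring
    rw [hfe, pow_succ']
    exact add_mem (Ideal.mul_mem_mul (Ideal.subset_span (by simp)) hg')
      (Ideal.mul_mem_mul (Ideal.subset_span (by simp)) hh')

theorem coeff_eq_zero_of_mem_span_X_pow_pow {F : Type*} [CommRing F] {q : ℕ} (hq : 0 < q) (k : ℕ) :
    ∀ f ∈ (Ideal.span {X 0 ^ q, X 1 ^ q} : Ideal (MvPowerSeries (Fin 2) F)) ^ k,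
      ∀ d, d 0 / q + d 1 / q < k → coeff d f = 0 := by
  classical
  induction k with
  | zero => exact fun f _ d hd => absurd hd (Nat.not_lt_zero _)
  | succ k ih =>
    intro f hf
    rw [pow_succ] at hf
    have key : ∀ (s : Fin 2), ∀ u ∈ (Ideal.span {X 0 ^ q, X 1 ^ q} :
        Ideal (MvPowerSeries (Fin 2) F)) ^ k, ∀ d : Fin 2 →₀ ℕ, d 0 / q + d 1 / q < k + 1 →
          coeff d (u * X s ^ q) = 0 := by
      intro s u hu d hd
      rw [X_pow_eq, coeff_mul_monomial]
      split_ifs with h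
      · rw [ih u hu, zero_mul]
        have hds : q ≤ d s := by simpa using h
        have h1 : (d s - q) / q + 1 = d s / q := by
          rw [← Nat.add_div_right _ hq, Nat.sub_add_cancel hds]
        fin_cases s <;> simp at h1 ⊢ <;> omega
      · rfl
    refine Submodule.mul_induction_on hf (fun u hu v hv d hd => ?_) fun x y hx hy d hd => ?_
    · obtain ⟨α, β, rfl⟩ := Ideal.mem_span_pair.1 hv
      rw [mul_add, ← mul_assoc, ← mul_assoc, map_add,
        key 0 _ (Ideal.mul_mem_right _ _ hu) d hd, key 1 _ (Ideal.mul_mem_right _ _ hu) d hd,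
        add_zero]
    · rw [map_add, hx d hd, hy d hd, add_zero]

section Dehomogenize

variable (F K : Type*) [Field F] [Field K] [Algebra F K]

theorem hasSubst_dehomogenize : HasSubst (S := Polynomial K)
    ![PowerSeries.C (Polynomial.X : Polynomial K) * PowerSeries.X, PowerSeries.X] :=
  hasSubst_of_constantCoeff_zero fun s => by
    fin_cases s
    · exact (PowerSeries.coeff_zero_eq_constantCoeff_apply _).symm.trans (by simp)
    · exact (PowerSeries.coeff_zero_eq_constantCoeff_apply _).symm.trans (by simp)

/-- The substitution `f(y, z) ↦ f(t w, w)`, as a power series in `w` over `K[t]`; the coefficient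
of `w ^ D` is the dehomogenization of the component of `f` of degree `D`. -/
noncomputable def dehomogenize : MvPowerSeries (Fin 2) F →ₐ[F] PowerSeries (Polynomial K) :=
  substAlgHom (hasSubst_dehomogenize K)

variable {F}

@[simp]
theorem dehomogenize_X_zero : dehomogenize F K (X 0) = PowerSeries.C Polynomial.X * PowerSeries.X :=
  substAlgHom_X (hasSubst_dehomogenize K) 0

@[simp]
theorem dehomogenize_X_one : dehomogenize F K (X 1) = PowerSeries.X :=
  substAlgHom_X (hasSubst_dehomogenize K) 1

theorem coeff_coeff_dehomogenize (f : MvPowerSeries (Fin 2) F) (D u : ℕ) :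
    (PowerSeries.coeff D (dehomogenize F K f)).coeff u =
      if u ≤ D then algebraMap F K (coeff (Finsupp.single 0 u + Finsupp.single 1 (D - u)) f)
      else 0 := by
  have h1 := coeff_subst (hasSubst_dehomogenize K) f (Finsupp.single () D)
  have h2 := coeff_subst_finite (hasSubst_dehomogenize K) f (Finsupp.single () D)
  rw [dehomogenize, substAlgHom_apply, PowerSeries.coeff, h1,
    ← Polynomial.lcoeff_apply, map_finsum _ h2]
  have h3 : ∀ d : Fin 2 →₀ ℕ, Polynomial.lcoeff K u (coeff d f • coeff (Finsupp.single () D)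
      (d.prod fun s e => ((![PowerSeries.C (Polynomial.X : Polynomial K) * PowerSeries.X,
        PowerSeries.X] : Fin 2 → PowerSeries (Polynomial K)) s) ^ e)) =
      if d 0 = u ∧ d 0 + d 1 = D then algebraMap F K (coeff d f) else 0 := by
    intro d
    have h4 : (d.prod fun s e => ((![PowerSeries.C (Polynomial.X : Polynomial K) * PowerSeries.X,
        PowerSeries.X] : Fin 2 → PowerSeries (Polynomial K)) s) ^ e) =
        PowerSeries.C (Polynomial.X ^ d 0) * PowerSeries.X ^ (d 0 + d 1) := by
      rw [Finsupp.prod_fintype _ _ (by simp)]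
      simp [mul_pow, pow_add, mul_assoc]
    have h5 : ∀ φ : PowerSeries (Polynomial K),
      coeff (Finsupp.single () D) φ = PowerSeries.coeff D φ := fun _ => rfl
    rw [h4, h5, PowerSeries.coeff_C_mul, PowerSeries.coeff_X_pow, Polynomial.lcoeff_apply,
      Polynomial.coeff_smul]
    by_cases hD : d 0 + d 1 = D
    · by_cases hu : d 0 = u
      · subst hD hu
        simp [Algebra.smul_def]
      · simp [hD, hu, Polynomial.coeff_X_pow, Ne.symm hu]
    · simp [hD, Ne.symm hD]
  simp_rw [h3]
  split_ifs with hu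
  · rw [finsum_eq_single _ (Finsupp.single 0 u + Finsupp.single 1 (D - u))]
    · simp [hu]
    · intro d hd
      rw [if_neg]
      rintro ⟨rfl, rfl⟩
      apply hd
      ext s
      fin_cases s <;> simp
  · rw [finsum_eq_zero_of_forall_eq_zero]
    intro d
    rw [if_neg]
    omega

theorem natDegree_coeff_dehomogenize_le (f : MvPowerSeries (Fin 2) F) (D : ℕ) :
    (PowerSeries.coeff D (dehomogenize F K f)).natDegree ≤ D := by
  rw [Polynomial.natDegree_le_iff_coeff_eq_zero]
  intro n hn
  rw [coeff_coeff_dehomogenize, if_neg (by omega)]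

theorem coeff_dehomogenize_ne_zero {f : MvPowerSeries (Fin 2) F} {d : Fin 2 →₀ ℕ}
    (hd : coeff d f ≠ 0) : PowerSeries.coeff (d 0 + d 1) (dehomogenize F K f) ≠ 0 := by
  intro h
  have := coeff_coeff_dehomogenize K f (d 0 + d 1) (d 0)
  rw [h, if_pos (by omega), Polynomial.coeff_zero, eq_comm, _root_.map_eq_zero] at this
  apply hd
  convert this
  ext s
  fin_cases s <;> simp

theorem dehomogenize_ne_zero {f : MvPowerSeries (Fin 2) F} (hf : f ≠ 0) :
    dehomogenize F K f ≠ 0 := by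
  obtain ⟨d, hd⟩ : ∃ d, coeff d f ≠ 0 := by
    by_contra! h
    exact hf (ext fun d => by simp [h d])
  exact fun h => coeff_dehomogenize_ne_zero K hd (by rw [h, map_zero])

/-- The dehomogenization of a nonzero power series has a leading coefficient. -/
theorem exists_dehomogenize_eq {f : MvPowerSeries (Fin 2) F} (hf : f ≠ 0) :
    ∃ (D : ℕ) (g : PowerSeries (Polynomial K)), dehomogenize F K f = PowerSeries.X ^ D * g ∧
      PowerSeries.constantCoeff g ≠ 0 ∧ (PowerSeries.constantCoeff g).natDegree ≤ D ∧
      ∀ d, coeff d f ≠ 0 → D ≤ d 0 + d 1 := by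
  have h0 := dehomogenize_ne_zero K hf
  set D := (dehomogenize F K f).order.toNat with hD
  have hDo : (dehomogenize F K f).order = D :=
    (ENat.natCast_toNat (by rwa [Ne, PowerSeries.order_eq_top])).symm
  obtain ⟨g, hg⟩ := PowerSeries.X_pow_order_dvd (φ := dehomogenize F K f)
  rw [← hD] at hg
  have hc : PowerSeries.coeff D (dehomogenize F K f) = PowerSeries.constantCoeff g := by
    rw [hg, PowerSeries.coeff_X_pow_mul', if_pos le_rfl, Nat.sub_self,
      PowerSeries.coeff_zero_eq_constantCoeff_apply]
  refine ⟨D, g, hg, ?_, ?_, fun d hd => ?_⟩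
  · rw [← hc]
    exact (PowerSeries.order_eq_nat.1 hDo).1
  · rw [← hc]
    exact natDegree_coeff_dehomogenize_le K f D
  · have := PowerSeries.order_le _ (coeff_dehomogenize_ne_zero K hd)
    rw [hDo] at this
    exact_mod_cast this

end Dehomogenize

theorem mem_span_X_pow_of_forall_mul_pow_mul_mem {F : Type*} [Field F] (p : ℕ) [Fact p.Prime]
    [CharP F p] {N i k : ℕ} (hpN : ¬ p ∣ N) (hi : i < N) {a f : MvPowerSeries (Fin 2) F}
    (ha : a ≠ 0) {E : ℕ}
    (h : ∀ e, E ≤ e → a * f ^ p ^ e * (X 0 ^ N + X 1 ^ N) ^ (i * p ^ e / N) ∈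
      (Ideal.span {X 0 ^ p ^ e, X 1 ^ p ^ e} : Ideal (MvPowerSeries (Fin 2) F)) ^ k) :
    f ∈ (Ideal.span {X 0, X 1} : Ideal (MvPowerSeries (Fin 2) F)) ^ (k + 1 - max i 1) := by
  refine mem_span_X_pow_of_coeff_eq_zero _ f fun d hd => ?_
  by_contra hfd
  have hf : f ≠ 0 := by rintro rfl; simp at hfd
  let K := AlgebraicClosure F
  have : CharP K p := charP_of_injective_algebraMap (algebraMap F K).injective p
  obtain ⟨δ, a', hΛa, ha0, haδ, -⟩ := exists_dehomogenize_eq K ha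
  obtain ⟨D, f', hΛf, hf0, -, hD⟩ := exists_dehomogenize_eq K hf
  have hDd := hD d hfd
  set e := max E (N * (δ + 1)) with he
  have hmem := h e (le_max_left _ _)
  have hqe : e < p ^ e := Nat.lt_pow_self (Fact.out : p.Prime).one_lt
  have hqN : N * (δ + 1) < p ^ e := lt_of_le_of_lt (le_max_right _ _) hqe
  clear_value e
  set q := p ^ e with hq
  have hN0 : 0 < N := by omega
  have hq0 : 0 < q := by omega
  have hδq : δ < q := by nlinarith
  set s := i * q / N with hs
  have hNs : N * s ≤ i * q := Nat.mul_div_le _ _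
  set T := δ + D * q + N * s with hT
  set G := PowerSeries.constantCoeff a' * (Polynomial.X ^ N + 1) ^ s with hG
  set H := PowerSeries.constantCoeff f' ^ q * G with hH
  have hXN : (Polynomial.X ^ N + 1 : Polynomial K) ≠ 0 := by
    rw [← Polynomial.C_1]
    exact Polynomial.X_pow_add_C_ne_zero hN0 1
  have hG0 : G ≠ 0 := mul_ne_zero ha0 (pow_ne_zero _ hXN)
  have hH0 : H ≠ 0 := mul_ne_zero (pow_ne_zero _ hf0) hG0
  have hΛ : PowerSeries.coeff T (dehomogenize F K
      (a * f ^ q * (X 0 ^ N + X 1 ^ N) ^ s)) = H := by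
    have h1 : dehomogenize F K (a * f ^ q * (X 0 ^ N + X 1 ^ N) ^ s) =
        PowerSeries.X ^ T * (a' * f' ^ q * PowerSeries.C ((Polynomial.X ^ N + 1) ^ s)) := by
      simp only [map_mul, map_pow, map_add, map_one, hΛa, hΛf, dehomogenize_X_zero,
        dehomogenize_X_one, hT]
      rw [show (PowerSeries.C (Polynomial.X : Polynomial K) * PowerSeries.X) ^ N +
        PowerSeries.X ^ N = PowerSeries.X ^ N * (PowerSeries.C (Polynomial.X) ^ N + 1) by ring]
      generalize PowerSeries.C (Polynomial.X : Polynomial K) ^ N + 1 = B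
      ring
    rw [h1, PowerSeries.coeff_X_pow_mul', if_pos le_rfl, Nat.sub_self,
      PowerSeries.coeff_zero_eq_constantCoeff_apply]
    simp only [map_mul, map_pow, PowerSeries.constantCoeff_C, hH, hG]
    ring
  have hcoeff : ∀ n, (n ≤ T → n / q + (T - n) / q < k) → H.coeff n = 0 := by
    intro n hn
    rw [← hΛ, coeff_coeff_dehomogenize]
    split_ifs with hnT
    · rw [coeff_eq_zero_of_mem_span_X_pow_pow hq0 k _ hmem _ (by simpa using hn hnT), map_zero]
    · rfl
  have hTk : k * q ≤ T := by
    by_contra! hlt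
    refine hH0 (Polynomial.ext fun n => ?_)
    rw [Polynomial.coeff_zero]
    refine hcoeff n fun hn => ?_
    calc n / q + (T - n) / q ≤ (n + (T - n)) / q := Nat.div_add_div_le_add_div
      _ = T / q := by rw [Nat.add_sub_cancel' hn]
      _ < k := (Nat.div_lt_iff_lt_mul hq0).2 hlt
  have hi1 : 1 ≤ i := by
    by_contra! hi0
    obtain rfl : i = 0 := by omega
    have hs0 : s = 0 := by simp [hs]
    have hDk : D + 1 ≤ k := by simp at hd; omega
    have : (D + 1) * q ≤ k * q := Nat.mul_le_mul_right _ hDk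
    rw [hs0] at hT
    nlinarith
  have hTδ : T ≤ k * q + δ := by
    have hDk : D + i ≤ k := by rw [max_eq_left hi1] at hd; omega
    have : (D + i) * q ≤ k * q := Nat.mul_le_mul_right _ hDk
    nlinarith
  have hδs : δ < s := by
    rw [← Nat.succ_le_iff, hs, Nat.le_div_iff_mul_le hN0]
    nlinarith
  refine hG0 (Polynomial.eq_zero_of_coeff_pow_mul_eq_zero p (e := e) (s := s) (M := T - k * q)
    hpN hf0 ?_ (by omega) ?_ (Dvd.intro_left _ rfl) fun n hn => hcoeff n fun hnT => ?_)
  · calc G.natDegree ≤ δ + s * N := by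
          refine Polynomial.natDegree_mul_le.trans (add_le_add haδ ?_)
          refine Polynomial.natDegree_pow_le.trans (Nat.mul_le_mul_left _ ?_)
          rw [← Polynomial.C_1, Polynomial.natDegree_X_pow_add_C]
      _ < (i + 1) * q := by nlinarith
      _ ≤ N * q := Nat.mul_le_mul_right _ hi
  · rw [← hq, hs]
    exact Nat.div_le_of_le_mul (Nat.mul_le_mul_right _ hi.le)
  · rw [← hq] at hn
    have hdm := Nat.div_add_mod n q
    set j := n / q
    have hjk : j < k := by
      by_contra! hkj
      have : q * k ≤ q * j := Nat.mul_le_mul_left _ hkj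
      have := mul_comm k q
      omega
    have : (T - n) / q < k - j := by
      rw [Nat.div_lt_iff_lt_mul hq0, Nat.sub_mul]
      have : q * (j + 1) ≤ q * k := Nat.mul_le_mul_left _ hjk
      have := mul_comm k q
      have := mul_comm j q
      rw [mul_add] at *
      omega
    omega

end MvPowerSeries

theorem Ideal.frobeniusPower_eq_map_iterateFrobenius {R : Type*} [CommRing R] (p : ℕ)
    [Fact p.Prime] [CharP R p] (I : Ideal R) (e : ℕ) :
    I.frobeniusPower (p ^ e) = I.map (iterateFrobenius R p e) :=
  rfl

theorem Ideal.memTightClosure_of_mem {R : Type*} [CommRing R] (p : ℕ) {I : Ideal R} {x : R}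
    (hx : x ∈ I) : I.memTightClosure p x := by
  refine ⟨1, fun P hP h => hP.1.1.ne_top ((Ideal.eq_top_iff_one P).2 h), 0, fun e _ => ?_⟩
  rw [one_mul]
  exact Ideal.subset_span ⟨x, hx, rfl⟩

theorem Ideal.span_pair_pow_le {R : Type*} [CommRing R] (y z : R) {q : ℕ} (hq : 0 < q) (k : ℕ) :
    (Ideal.span {y, z} : Ideal R) ^ ((k + 1) * q) ≤ Ideal.span {y ^ q, z ^ q} ^ k := by
  have hpow : ∀ n, (Ideal.span {y, z} : Ideal R) ^ n ≤
      Ideal.span {w | ∃ u v, u + v = n ∧ w = y ^ u * z ^ v} := by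
    intro n
    induction n with
    | zero =>
      rw [pow_zero, Ideal.one_eq_top, top_le_iff, Ideal.eq_top_iff_one]
      exact Ideal.subset_span ⟨0, 0, by simp⟩
    | succ n ih =>
      rw [pow_succ]
      refine (Ideal.mul_mono_left ih).trans ?_
      rw [Ideal.span_mul_span', Ideal.span_le]
      rintro _ ⟨_, ⟨u, v, huv, rfl⟩, w, hw, rfl⟩
      rcases hw with rfl | rfl
      · exact Ideal.subset_span ⟨u + 1, v, by omega, by simp; ring⟩
      · exact Ideal.subset_span ⟨u, v + 1, by omega, by simp; ring⟩
  refine (hpow _).trans (Ideal.span_le.2 ?_)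
  rintro _ ⟨u, v, huv, rfl⟩
  have hk : k ≤ u / q + v / q := by
    have hu := Nat.lt_div_mul_add (a := u) hq
    have hv := Nat.lt_div_mul_add (a := v) hq
    by_contra! h
    have : (u / q + v / q + 1) * q ≤ k * q := Nat.mul_le_mul_right _ h
    nlinarith
  have h1 : (y ^ q) ^ (u / q) * (z ^ q) ^ (v / q) ∣ y ^ u * z ^ v := by
    rw [← pow_mul, ← pow_mul]
    exact mul_dvd_mul (pow_dvd_pow _ (Nat.mul_div_le _ _)) (pow_dvd_pow _ (Nat.mul_div_le _ _))
  refine Ideal.mem_of_dvd _ h1 (Ideal.pow_le_pow_right hk ?_)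
  rw [pow_add]
  exact Ideal.mul_mem_mul (Ideal.pow_mem_pow (Ideal.subset_span (by simp)) _)
    (Ideal.pow_mem_pow (Ideal.subset_span (by simp)) _)

theorem Ideal.span_triple_pow_le {R : Type*} [CommRing R] (x y z : R) (n : ℕ) :
    (Ideal.span {x, y, z} : Ideal R) ^ n ≤
      Ideal.span {w | ∃ a b, a + b = n ∧
        ∃ v ∈ (Ideal.span {y, z} : Ideal R) ^ b, w = x ^ a * v} := by
  induction n with
  | zero =>
    rw [pow_zero, Ideal.one_eq_top, top_le_iff, Ideal.eq_top_iff_one]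
    exact Ideal.subset_span ⟨0, 0, rfl, 1, by simp⟩
  | succ n ih =>
    rw [pow_succ]
    refine (Ideal.mul_mono_left ih).trans ?_
    rw [Ideal.span_mul_span', Ideal.span_le]
    rintro _ ⟨_, ⟨a, b, hab, v, hv, rfl⟩, w, hw, rfl⟩
    have key : ∀ w ∈ (Ideal.span {y, z} : Ideal R), x ^ a * v * w ∈ Ideal.span
        {w | ∃ a b, a + b = n + 1 ∧ ∃ v ∈ (Ideal.span {y, z} : Ideal R) ^ b, w = x ^ a * v} := by
      intro w hw
      refine Ideal.subset_span ⟨a, b + 1, by omega, v * w, ?_, mul_assoc _ _ _⟩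
      rw [pow_succ]
      exact Ideal.mul_mem_mul hv hw
    rcases hw with rfl | hw
    · exact Ideal.subset_span ⟨a + 1, b, by omega, v, hv, by simp; ring⟩
    · exact key w (Ideal.subset_span hw)

theorem Module.Basis.repr_mem_of_mem_map {ι A R : Type*} [CommRing A] [CommRing R] [Algebra A R]
    (b : Module.Basis ι A R) {J : Ideal A} {w : R} (hw : w ∈ J.map (algebraMap A R)) (i : ι) :
    b.repr w i ∈ J := by
  have hw' : w ∈ (J • ⊤ : Submodule A R) := by
    rw [Ideal.smul_top_eq_map]
    exact hw
  refine Submodule.smul_induction_on hw' (fun r hr n _ => ?_) fun u v hu hv => ?_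
  · simpa using J.mul_mem_right _ hr
  · simpa using J.add_mem hu hv

theorem exists_mul_eq_algebraMap_of_notMem_minimalPrimes {A R : Type*} [CommRing A] [IsDomain A]
    [CommRing R] [Algebra A R] [Algebra.IsIntegral A R] {c : R}
    (hc : ∀ P ∈ minimalPrimes R, c ∉ P) : ∃ a : A, a ≠ 0 ∧ c ∣ algebraMap A R a := by
  by_contra! h
  obtain ⟨P, hP, hcP, hPS⟩ := Ideal.exists_le_prime_disjoint (Ideal.span {c})
    ((nonZeroDivisors A).map (algebraMap A R)) (by
      rw [Set.disjoint_left]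
      rintro _ hw ⟨a, ha, rfl⟩
      exact h a (nonZeroDivisors.ne_zero ha) (Ideal.mem_span_singleton.1 hw))
  obtain ⟨P', hP', hle⟩ := Ideal.exists_minimalPrimes_le (I := (⊥ : Ideal R)) (J := P) bot_le
  have hP'p : P'.IsPrime := hP'.1.1
  refine hc P' hP' ?_
  suffices P' = P by
    rw [this]
    exact hcP (Ideal.mem_span_singleton_self c)
  by_contra hne
  have hlt := Ideal.IsIntegral.comap_lt_comap (R := A) (lt_of_le_of_ne hle hne)
  obtain ⟨a, ha, ha'⟩ := SetLike.exists_of_lt hlt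
  have ha0 : a ≠ 0 := by
    rintro rfl
    exact ha' (zero_mem _)
  exact Set.disjoint_left.1 hPS ha ⟨a, mem_nonZeroDivisors_of_ne_zero ha0, rfl⟩

section Diagonal

variable {F R : Type*} [Field F] [CommRing R] [Algebra (MvPowerSeries (Fin 2) F) R] {N : ℕ}
  {x y z : R}

theorem memTightClosure_of_mem_span_pow_succ
    (b : Module.Basis (Fin N) (MvPowerSeries (Fin 2) F) R)
    (hy : y = algebraMap (MvPowerSeries (Fin 2) F) R (X 0))
    (hxN : x ^ N = -(y ^ N + z ^ N))
    (p : ℕ) [Fact p.Prime] (hN : 0 < N) [CharP R p]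
    {k α β : ℕ} (hk : α + β = k + 1) {v : R} (hv : v ∈ (Ideal.span {y, z} : Ideal R) ^ β) :
    (Ideal.span {y, z} ^ k : Ideal R).memTightClosure p (x ^ α * v) := by
  have hyI : y ∈ (Ideal.span {y, z} : Ideal R) := Ideal.subset_span (by simp)
  have hzI : z ∈ (Ideal.span {y, z} : Ideal R) := Ideal.subset_span (by simp)
  have := b.isTorsionFree
  refine ⟨y ^ N, fun P hP hyP => ?_, 0, fun e _ => ?_⟩
  · have hy0 : y ∈ nonZeroDivisors R := by
      rw [mem_nonZeroDivisors_iff_right]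
      intro w hw
      rw [hy, mul_comm, ← Algebra.smul_def, smul_eq_zero] at hw
      refine hw.resolve_left fun h => one_ne_zero (α := F) ?_
      rw [← coeff_index_single_self_X (R := F) (0 : Fin 2), h, map_zero]
    exact Set.disjoint_left.1 (Ideal.disjoint_nonZeroDivisors_of_mem_minimalPrimes hP) hyP
      (pow_mem hy0 N)
  · have hq : 0 < p ^ e := pow_pos (Fact.out : p.Prime).pos e
    rw [Ideal.frobeniusPower_eq_map_iterateFrobenius, Ideal.map_pow, Ideal.map_span, Set.image_pair,
      iterateFrobenius_def, iterateFrobenius_def]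
    refine Ideal.span_pair_pow_le y z hq k ?_
    set q := p ^ e
    have hxI : x ^ N ∈ (Ideal.span {y, z} : Ideal R) ^ N := by
      rw [hxN]
      exact neg_mem (add_mem (Ideal.pow_mem_pow hyI _) (Ideal.pow_mem_pow hzI _))
    have h1 : y ^ N * (x ^ α * v) ^ q =
        x ^ (α * q % N) * (y ^ N * ((x ^ N) ^ (α * q / N) * v ^ q)) := by
      rw [mul_pow, ← pow_mul, ← pow_mul]
      conv_lhs => rw [← Nat.div_add_mod (α * q) N, pow_add]
      ring
    rw [h1]
    refine Ideal.mul_mem_left _ _ (Ideal.pow_le_pow_right (m := (k + 1) * q)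
      (n := N + (N * (α * q / N) + β * q)) ?_ ?_)
    · have := Nat.div_add_mod (α * q) N
      have := Nat.mod_lt (α * q) hN
      rw [← hk, add_mul]
      omega
    · rw [pow_add, pow_add, pow_mul, pow_mul]
      exact Ideal.mul_mem_mul (Ideal.pow_mem_pow hyI _)
        (Ideal.mul_mem_mul (Ideal.pow_mem_pow hxI _) (Ideal.pow_mem_pow hv _))

theorem repr_pow_mul_mem
    (b : Module.Basis (Fin N) (MvPowerSeries (Fin 2) F) R)
    (hb : ∀ i, b i = x ^ (i : ℕ))
    (hy : y = algebraMap (MvPowerSeries (Fin 2) F) R (X 0))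
    (hz : z = algebraMap (MvPowerSeries (Fin 2) F) R (X 1))
    (hxN : x ^ N = -(y ^ N + z ^ N))
    (p : ℕ) [Fact p.Prime] [CharP F p] [CharP R p] (hpN : ¬ p ∣ N)
    (k e : ℕ) {a : MvPowerSeries (Fin 2) F} {w : R}
    (h : a • w ^ p ^ e ∈ (Ideal.span {y, z} ^ k : Ideal R).frobeniusPower (p ^ e)) (i : Fin N) :
    a * b.repr w i ^ p ^ e * (X 0 ^ N + X 1 ^ N) ^ (i * p ^ e / N) ∈
      (Ideal.span {X 0 ^ p ^ e, X 1 ^ p ^ e} : Ideal (MvPowerSeries (Fin 2) F)) ^ k := by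
  have hN : 0 < N := i.pos
  have hJ : (Ideal.span {y, z} ^ k : Ideal R).frobeniusPower (p ^ e) =
      ((Ideal.span {X 0 ^ p ^ e, X 1 ^ p ^ e} : Ideal (MvPowerSeries (Fin 2) F)) ^ k).map
        (algebraMap _ R) := by
    rw [Ideal.frobeniusPower_eq_map_iterateFrobenius, Ideal.map_pow, Ideal.map_span,
      Ideal.map_pow, Ideal.map_span, Set.image_pair, Set.image_pair, iterateFrobenius_def,
      iterateFrobenius_def, hy, hz,
      map_pow, map_pow]
  rw [hJ] at h
  set q := p ^ e with hq
  let σ : Fin N → Fin N := fun j => ⟨j * q % N, Nat.mod_lt _ hN⟩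
  have hσ : Function.Injective σ := by
    intro j₁ j₂ hj
    have hcop : N.gcd q = 1 :=
      Nat.Coprime.pow_right e (((Fact.out : p.Prime).coprime_iff_not_dvd.2 hpN).symm)
    have h1 : (j₁ : ℕ) * q ≡ j₂ * q [MOD N] := congrArg Fin.val hj
    have h2 := Nat.ModEq.cancel_right_of_coprime hcop h1
    exact Fin.ext (Nat.ModEq.eq_of_lt_of_lt h2 j₁.2 j₂.2)
  have hxA : x ^ N = algebraMap (MvPowerSeries (Fin 2) F) R (-(X 0 ^ N + X 1 ^ N)) := by
    rw [hxN, hy, hz, map_neg, map_add, map_pow, map_pow]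
  have hw : a • w ^ q = ∑ j, (a * b.repr w j ^ q *
      (-(X 0 ^ N + X 1 ^ N)) ^ (j * q / N)) • b (σ j) := by
    conv_lhs => rw [← b.sum_repr w, hq, sum_pow_char_pow, ← hq, Finset.smul_sum]
    refine Finset.sum_congr rfl fun j _ => ?_
    rw [hb, hb, smul_pow, ← pow_mul, smul_smul]
    conv_lhs => rw [← Nat.div_add_mod (j * q) N, pow_add, pow_mul, hxA,
      ← map_pow (algebraMap (MvPowerSeries (Fin 2) F) R), ← Algebra.smul_def, smul_smul]
  have h1 := b.repr_mem_of_mem_map h (σ i)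
  rw [hw, map_sum, Finsupp.finsetSum_apply, Finset.sum_eq_single_of_mem i (Finset.mem_univ _)]
    at h1
  · rw [map_smul, b.repr_self, Finsupp.smul_single_one, Finsupp.single_eq_same, neg_pow] at h1
    have h2 := Ideal.mul_mem_left _ ((-1) ^ (i * q / N)) h1
    convert h2 using 1
    have h3 : (-1 : MvPowerSeries (Fin 2) F) ^ (i * q / N) * (-1) ^ (i * q / N) = 1 := by
      rw [← mul_pow]; simp
    linear_combination (-(a * b.repr w i ^ q * (X 0 ^ N + X 1 ^ N) ^ ((i : ℕ) * q / N))) * h3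
  · intro j _ hj
    rw [map_smul, b.repr_self, Finsupp.smul_single_one,
      Finsupp.single_eq_of_ne (fun h => hj (hσ h.symm))]

theorem tightClosure_span_pow_of_basis
    (b : Module.Basis (Fin N) (MvPowerSeries (Fin 2) F) R)
    (hb : ∀ i, b i = x ^ (i : ℕ))
    (hy : y = algebraMap (MvPowerSeries (Fin 2) F) R (X 0))
    (hz : z = algebraMap (MvPowerSeries (Fin 2) F) R (X 1))
    (hxN : x ^ N = -(y ^ N + z ^ N))
    (p : ℕ) [Fact p.Prime] [CharP F p] (hpN : ¬ p ∣ N)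
    (k : ℕ) : Ideal.tightClosure p (Ideal.span {y, z} ^ k : Ideal R) =
      Ideal.span {x, y, z} ^ (k + 1) + Ideal.span {y, z} ^ k := by
  have hN : 0 < N := Nat.pos_of_ne_zero fun h => hpN (h ▸ dvd_zero p)
  have hNT : Nontrivial R := ⟨⟨b ⟨0, hN⟩, 0, b.ne_zero _⟩⟩
  have : IsDomain (MvPowerSeries (Fin 2) F) := NoZeroDivisors.to_isDomain _
  have := b.isTorsionFree
  have : CharP (MvPowerSeries (Fin 2) F) p :=
    charP_of_injective_algebraMap (algebraMap F (MvPowerSeries (Fin 2) F)).injective p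
  have : CharP R p := charP_of_injective_algebraMap
    (FaithfulSMul.algebraMap_injective (MvPowerSeries (Fin 2) F) R) p
  have : Module.Finite (MvPowerSeries (Fin 2) F) R := .of_basis b
  apply le_antisymm
  · refine Ideal.span_le.2 fun w hw => ?_
    obtain ⟨c, hc, E, hE⟩ := hw
    obtain ⟨a, ha0, c', hac⟩ := exists_mul_eq_algebraMap_of_notMem_minimalPrimes
      (A := MvPowerSeries (Fin 2) F) hc
    have hmem : ∀ i : Fin N, b.repr w i ∈
        (Ideal.span {X 0, X 1} : Ideal (MvPowerSeries (Fin 2) F)) ^ (k + 1 - max (i : ℕ) 1) := by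
      refine fun i => MvPowerSeries.mem_span_X_pow_of_forall_mul_pow_mul_mem p hpN i.2 ha0
        (E := E) (k := k) fun e he => ?_
      refine repr_pow_mul_mem b hb hy hz hxN p hpN k e ?_ i
      rw [Algebra.smul_def, hac, mul_comm c, mul_assoc]
      exact Ideal.mul_mem_left _ _ (hE e he)
    rw [SetLike.mem_coe, ← b.sum_repr w]
    refine sum_mem fun i _ => ?_
    have h1 : algebraMap _ R (b.repr w i) ∈ (Ideal.span {y, z} : Ideal R) ^
        (k + 1 - max (i : ℕ) 1) := by
      have := Ideal.mem_map_of_mem (algebraMap _ R) (hmem i)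
      rwa [Ideal.map_pow, Ideal.map_span, Set.image_pair, ← hy, ← hz] at this
    rw [Algebra.smul_def, hb]
    rcases le_or_gt (i : ℕ) 1 with hi | hi
    · rw [max_eq_right hi, Nat.add_sub_cancel] at h1
      exact Ideal.mem_sup_right (Ideal.mul_mem_right _ _ h1)
    · rw [max_eq_left hi.le] at h1
      refine Ideal.mem_sup_left (Ideal.pow_le_pow_right (m := k + 1)
        (n := (k + 1 - i) + i) (by omega) ?_)
      rw [pow_add]
      refine Ideal.mul_mem_mul (Ideal.pow_right_mono (Ideal.span_mono ?_) _ h1)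
        (Ideal.pow_mem_pow (Ideal.subset_span (by simp)) _)
      exact Set.subset_insert _ _
  · refine sup_le ((Ideal.span_triple_pow_le x y z (k + 1)).trans (Ideal.span_le.2 ?_))
      fun w hw => Ideal.subset_span (Ideal.memTightClosure_of_mem p hw)
    rintro _ ⟨α, β, hαβ, v, hv, rfl⟩
    exact Ideal.subset_span (memTightClosure_of_mem_span_pow_succ b hy hxN p hN hαβ hv)

end Diagonal

/-- The diagonal hypersurface is finite free over the power series ring in the last two variables,
with basis the powers of the first variable. -/
theorem exists_algebra_basis_diagonal (F : Type*) [Field F] {N : ℕ} (hN : 0 < N)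
    (Q : Ideal (MvPowerSeries (Fin 3) F))
    (hQ : Q = Ideal.span {(X 0 : MvPowerSeries (Fin 3) F) ^ N + X 1 ^ N + X 2 ^ N}) :
    ∃ (_ : Algebra (MvPowerSeries (Fin 2) F) (MvPowerSeries (Fin 3) F ⧸ Q))
      (b : Module.Basis (Fin N) (MvPowerSeries (Fin 2) F) (MvPowerSeries (Fin 3) F ⧸ Q)),
      (∀ i, b i = Ideal.Quotient.mk Q (X 0) ^ (i : ℕ)) ∧
      algebraMap _ _ (X 0 : MvPowerSeries (Fin 2) F) = Ideal.Quotient.mk Q (X 1) ∧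
      algebraMap _ _ (X 1 : MvPowerSeries (Fin 2) F) = Ideal.Quotient.mk Q (X 2) := by
  set A := MvPowerSeries (Fin 2) F
  set g : Polynomial A := Polynomial.X ^ N + Polynomial.C (X 0 ^ N + X 1 ^ N) with hg
  have hgm : g.Monic := Polynomial.monic_X_pow_add_C _ hN.ne'
  have hgN : g.natDegree = N := Polynomial.natDegree_X_pow_add_C
  have hgd : g.IsDistinguishedAt (Ideal.span (Set.range X) : Ideal A) := by
    refine ⟨⟨fun {n} hn => ?_⟩, hgm⟩
    rw [hgN] at hn
    have hX : ∀ i, (X i : A) ∈ (Ideal.span (Set.range X) : Ideal A) :=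
      fun i => Ideal.subset_span ⟨i, rfl⟩
    rw [hg, Polynomial.coeff_add, Polynomial.coeff_X_pow, if_neg hn.ne, zero_add,
      Polynomial.coeff_C]
    split_ifs
    · exact add_mem (Ideal.pow_mem_of_mem _ (hX 0) _ hN) (Ideal.pow_mem_of_mem _ (hX 1) _ hN)
    · exact zero_mem _
  let e₁ : AdjoinRoot g ≃+* PowerSeries A ⧸ Ideal.span {(g : PowerSeries A)} :=
    hgd.algEquivQuotient.toRingEquiv
  let e₂ : MvPowerSeries (Fin 3) F ⧸ Q ≃+* PowerSeries A ⧸ Ideal.span {(g : PowerSeries A)} :=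
    Ideal.quotientEquiv Q _ (finSuccEquiv F 2).toRingEquiv (by
      have h0 : (finSuccEquiv F 2) (X 0) = PowerSeries.X := finSuccEquiv_X_zero
      have h1 : (finSuccEquiv F 2) (X 1) = PowerSeries.C (X 0) := finSuccEquiv_X_succ 0
      have h2 : (finSuccEquiv F 2) (X 2) = PowerSeries.C (X 1) := finSuccEquiv_X_succ 1
      rw [hQ, Ideal.map_span, Set.image_singleton]
      simp [hg, h0, h1, h2, add_assoc])
  let e : AdjoinRoot g ≃+* MvPowerSeries (Fin 3) F ⧸ Q := e₁.trans e₂.symm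
  have he : ∀ (P : Polynomial A) (w : MvPowerSeries (Fin 3) F), finSuccEquiv F 2 w = P →
      e (AdjoinRoot.mk g P) = Ideal.Quotient.mk Q w := by
    intro P w hw
    apply e₂.injective
    change e₂ (e₂.symm (Ideal.Quotient.mk _ (P : PowerSeries A))) =
      Ideal.Quotient.mk _ (finSuccEquiv F 2 w)
    rw [RingEquiv.apply_symm_apply, hw]
  let inst : Algebra A (MvPowerSeries (Fin 3) F ⧸ Q) :=
    ((e : AdjoinRoot g →+* _).comp (algebraMap A (AdjoinRoot g))).toAlgebra
  let eL : AdjoinRoot g ≃ₐ[A] MvPowerSeries (Fin 3) F ⧸ Q :=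
    AlgEquiv.ofRingEquiv (f := e) fun _ => rfl
  refine ⟨inst, ((AdjoinRoot.powerBasis' hgm).basis.map eL.toLinearEquiv).reindex
    (finCongr hgN), fun i => ?_, ?_, ?_⟩
  · have h0 : e (AdjoinRoot.root g) = Ideal.Quotient.mk Q (X 0) :=
      he Polynomial.X (X 0) (by rw [Polynomial.coe_X]; exact finSuccEquiv_X_zero)
    rw [Module.Basis.reindex_apply, Module.Basis.map_apply, PowerBasis.basis_eq_pow,
      AdjoinRoot.powerBasis'_gen, ← h0]
    exact map_pow e (AdjoinRoot.root g) (i : ℕ)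
  · exact he (Polynomial.C (X 0)) (X 1) (by simpa using finSuccEquiv_X_succ (R := F) (0 : Fin 2))
  · exact he (Polynomial.C (X 1)) (X 2) (by simpa using finSuccEquiv_X_succ (R := F) (1 : Fin 2))


/-- **Tight closure of powers of a parameter ideal in a diagonal hypersurface.** Let
`R = F[[X,Y,Z]]/(X^N + Y^N + Z^N)` with `N ≥ 3`, `F` an infinite field of prime
characteristic `p` with `p ∤ N`. Let `I = (y, z)` and `m = (x, y, z)`. Then for all
`k ≥ 1`, `(I^k)^* = m^{k+1} + I^k`. -/
theorem diagonal_tight_closure_of_powers (F : Type*) [Field F] [Infinite F]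
    (p : ℕ) [Fact p.Prime] [CharP F p] (N : ℕ) (hN : 3 ≤ N) (hpN : ¬ p ∣ N)
    (Q : Ideal (MvPowerSeries (Fin 3) F))
    (hQ : Q = Ideal.span {(X 0 : MvPowerSeries (Fin 3) F) ^ N + X 1 ^ N + X 2 ^ N})
    (I m : Ideal (MvPowerSeries (Fin 3) F ⧸ Q))
    (hI : I = Ideal.span {Ideal.Quotient.mk Q (X 1), Ideal.Quotient.mk Q (X 2)})
    (hm : m = Ideal.span {Ideal.Quotient.mk Q (X 0), Ideal.Quotient.mk Q (X 1),
      Ideal.Quotient.mk Q (X 2)}) :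
    ∀ k : ℕ, 1 ≤ k → Ideal.tightClosure p (I ^ k) = m ^ (k + 1) + I ^ k := by
  intro k _
  obtain ⟨_, b, hb, hy, hz⟩ := exists_algebra_basis_diagonal F (by omega : 0 < N) Q hQ
  rw [hI, hm]
  refine tightClosure_span_pow_of_basis b hb hy.symm hz.symm ?_ p hpN k
  rw [eq_neg_iff_add_eq_zero, ← add_assoc, ← map_pow, ← map_pow, ← map_pow, ← map_add, ← map_add,
    Ideal.Quotient.eq_zero_iff_mem, hQ]
  exact Ideal.mem_span_singleton_self _
end
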